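/- Every saturated Θ^2-drawing of a graph G on n ≥ 3 vertices (vertices in general position in ℝ², not necessarily in convex position) has at least 3n − 6 edges. -/

import Mathlib

/-- Points of the plane. -/
abbrev Pt : Type := ℝ × ℝ

/-- Two straight-line segments cross if some point lies in the interior
(open segment) of both. -/
def SegCross (a b c d : Pt) : Prop :=
  ∃ x : Pt, x ∈ openSegment ℝ a b ∧ x ∈ openSegment ℝ c d

/-- Two edges (unordered pairs of vertices) cross in the drawing `p`. -/
def EdgeCross {V : Type} (p : V → Pt) (e f : Sym2 V) : Prop :=
  ∃ u v x y : V, e = s(u, v) ∧ f = s(x, y) ∧ SegCross (p u) (p v) (p x) (p y)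

/-- The drawing `p` is injective and no three vertex points are collinear. -/
def GenPos {V : Type} (p : V → Pt) : Prop :=
  Function.Injective p ∧
    ∀ u v w : V, u ≠ v → u ≠ w → v ≠ w → ¬ Collinear ℝ ({p u, p v, p w} : Set Pt)

/-- The vertex points are in convex position: every vertex point is an extreme
point of the convex hull of all vertex points. -/
def ConvexPos {V : Type} (p : V → Pt) : Prop :=
  ∀ v : V, p v ∈ Set.extremePoints ℝ (convexHull ℝ (Set.range p))

/-- A `k`-coloring of the edges of `G` is crossing-free if no two distinct
edges of the same color cross. -/
def CrossingFree {V : Type} {k : ℕ} (G : SimpleGraph V) (p : V → Pt)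
    (φ : Sym2 V → Fin k) : Prop :=
  ∀ e ∈ G.edgeSet, ∀ f ∈ G.edgeSet, e ≠ f → φ e = φ f → ¬ EdgeCross p e f

open scoped Classical

/-- A precolored drawing `(G, p, φ)` is saturated: for every pair of distinct
non-adjacent vertices and every color `c`, assigning color `c` to the new edge
`uv` yields a coloring that is not crossing-free. -/
def PrecoloredSaturated {V : Type} {k : ℕ} (G : SimpleGraph V) (p : V → Pt)
    (φ : Sym2 V → Fin k) : Prop :=
  ∀ u v : V, u ≠ v → ¬ G.Adj u v → ∀ c : Fin k,
    ¬ CrossingFree (G ⊔ SimpleGraph.fromEdgeSet {s(u, v)}) p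
      (fun e => if e = s(u, v) then c else φ e)

/-- A (non-precolored) drawing of `G` is saturated for thickness `k`: for every
pair of distinct non-adjacent vertices `u, v`, the drawing of `G + uv` admits
no crossing-free `k`-coloring. -/
def Saturated {V : Type} (k : ℕ) (G : SimpleGraph V) (p : V → Pt) : Prop :=
  ∀ u v : V, u ≠ v → ¬ G.Adj u v →
    ∀ φ : Sym2 V → Fin k,
      ¬ CrossingFree (G ⊔ SimpleGraph.fromEdgeSet {s(u, v)}) p φ

/-- Twice the signed area of the triangle `a b c`. -/
def det2 (a b c : Pt) : ℝ :=
  (b.1 - a.1) * (c.2 - a.2) - (b.2 - a.2) * (c.1 - a.1)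

/-- An edge is an outer edge if its endpoints are consecutive on the boundary
of the convex hull of the vertex points, i.e. all other vertex points lie
strictly on one side of the line through its endpoints. -/
def IsOuterEdge {V : Type} (p : V → Pt) (e : Sym2 V) : Prop :=
  ∃ u v : V, e = s(u, v) ∧
    ((∀ w : V, w ≠ u → w ≠ v → 0 < det2 (p u) (p v) (p w)) ∨
     (∀ w : V, w ≠ u → w ≠ v → det2 (p u) (p v) (p w) < 0))


namespace TH

def lp (t : ℝ) (a b : Pt) : Pt := ((1 - t) * a.1 + t * b.1, (1 - t) * a.2 + t * b.2)

lemma mem_open_iff (a b x : Pt) :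
    x ∈ openSegment ℝ a b ↔ ∃ t : ℝ, 0 < t ∧ t < 1 ∧ x = lp t a b := by
  constructor
  · rintro ⟨s, t, hs, ht, hst, rfl⟩
    refine ⟨t, ht, by linarith, ?_⟩
    have : s = 1 - t := by linarith
    subst this
    ext <;> simp [lp]
  · rintro ⟨t, h0, h1, rfl⟩
    refine ⟨1 - t, t, by linarith, h0, by ring, ?_⟩
    ext <;> simp [lp]

lemma segCross_iff (a b c d : Pt) : SegCross a b c d ↔
    ∃ s t : ℝ, 0 < s ∧ s < 1 ∧ 0 < t ∧ t < 1 ∧ lp s a b = lp t c d := by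
  unfold SegCross
  simp only [mem_open_iff]
  constructor
  · rintro ⟨x, ⟨s, h0, h1, rfl⟩, ⟨t, h2, h3, h⟩⟩
    exact ⟨s, t, h0, h1, h2, h3, h⟩
  · rintro ⟨s, t, h0, h1, h2, h3, h⟩
    exact ⟨_, ⟨s, h0, h1, rfl⟩, ⟨t, h2, h3, h⟩⟩

lemma lp_symm (t : ℝ) (a b : Pt) : lp t a b = lp (1 - t) b a := by
  ext <;> simp [lp] <;> ring

lemma segCross_comm {a b c d : Pt} (h : SegCross a b c d) : SegCross c d a b := by
  obtain ⟨x, h1, h2⟩ := h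
  exact ⟨x, h2, h1⟩

lemma segCross_swap1 {a b c d : Pt} (h : SegCross a b c d) : SegCross b a c d := by
  obtain ⟨x, h1, h2⟩ := h
  exact ⟨x, by rwa [openSegment_symm], h2⟩

lemma lp_lp1 (l t : ℝ) (g h : Pt) : lp l (lp t g h) g = lp ((1 - l) * t) g h := by
  ext <;> simp [lp] <;> ring

lemma lp_lp2 (l t : ℝ) (g h : Pt) : lp l g (lp t g h) = lp (l * t) g h := by
  ext <;> simp [lp] <;> ring

lemma d3 (a b c d : Pt) (t : ℝ) :
    det2 a b (lp t c d) = (1 - t) * det2 a b c + t * det2 a b d := by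
  simp [det2, lp]; ring
lemma d2 (a b c d : Pt) (t : ℝ) :
    det2 a (lp t c d) b = (1 - t) * det2 a c b + t * det2 a d b := by
  simp [det2, lp]; ring
lemma d1 (a b c d : Pt) (t : ℝ) :
    det2 (lp t c d) a b = (1 - t) * det2 c a b + t * det2 d a b := by
  simp [det2, lp]; ring
lemma dcyc (a b c : Pt) : det2 a b c = det2 b c a := by simp [det2]; ring
lemma dsw (a b c : Pt) : det2 a b c = - det2 b a c := by simp [det2]; ring
lemma dsw2 (a b c : Pt) : det2 a b c = - det2 a c b := by simp [det2]; ring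
@[simp] lemma daa (a b : Pt) : det2 a a b = 0 := by simp [det2]
@[simp] lemma dab (a b : Pt) : det2 a b a = 0 := by simp [det2]
@[simp] lemma dbb (a b : Pt) : det2 a b b = 0 := by simp [det2]; ring
lemma dsum (a b c x : Pt) : det2 x b c + det2 a x c + det2 a b x = det2 a b c := by
  simp [det2]; ring

/-- reconstruct a point on a side from barycentric coordinates -/
lemma on_side {a b c x : Pt} (hD : 0 < det2 a b c) (h0 : det2 x b c = 0) :
    x = lp (det2 a b x / det2 a b c) b c := by
  have h1 : det2 a x c = det2 a b c - det2 a b x := by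
    have := dsum a b c x; linarith
  have e1 : det2 a b c * x.1 = det2 x b c * a.1 + det2 a x c * b.1 + det2 a b x * c.1 := by
    simp [det2]; ring
  have e2 : det2 a b c * x.2 = det2 x b c * a.2 + det2 a x c * b.2 + det2 a b x * c.2 := by
    simp [det2]; ring
  rw [h0, h1] at e1 e2
  generalize det2 a b x = g at *
  generalize det2 a b c = D at *
  ext
  · simp only [lp]; field_simp; linarith
  · simp only [lp]; field_simp; linarith

/-- First exit. -/
lemma exit3 (x y : Fin 3 → ℝ) (hx : ∀ i, 0 ≤ x i) (hxy : ∀ i, y i < 0 → 0 < x i)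
    (hy : ∃ i, y i < 0) : ∃ i, ∃ l : ℝ, y i < 0 ∧ 0 < l ∧ l < 1 ∧
      (1 - l) * x i + l * y i = 0 ∧ ∀ j, 0 ≤ (1 - l) * x j + l * y j := by
  obtain ⟨i0, hi0⟩ := hy
  obtain ⟨i, hi, hmin⟩ := Finset.exists_min_image (Finset.univ.filter fun i => y i < 0)
    (fun i => x i / (x i - y i)) ⟨i0, by simpa using hi0⟩
  simp only [Finset.mem_filter, Finset.mem_univ, true_and] at hi hmin
  have hxi := hxy i hi
  have hpos : 0 < x i - y i := by linarith
  have hl0 : 0 < x i / (x i - y i) := by positivity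
  have hl1 : x i / (x i - y i) < 1 := by rw [div_lt_one hpos]; linarith
  refine ⟨i, x i / (x i - y i), hi, hl0, hl1, by field_simp; ring, fun j => ?_⟩
  by_cases hj : y j < 0
  · have h := hmin j hj
    have hxj := hxy j hj
    rw [le_div_iff₀ (by linarith)] at h
    linarith
  · have : 0 ≤ (1 - x i / (x i - y i)) * x j := mul_nonneg (by linarith) (hx j)
    have : 0 ≤ (x i / (x i - y i)) * y j := mul_nonneg hl0.le (by linarith)
    linarith

lemma triExit (a b c q g : Pt) (hD : 0 < det2 a b c) (q1 : 0 ≤ det2 q b c)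
    (q1' : det2 g b c < 0 → 0 < det2 q b c) (q2 : 0 < det2 a q c) (q3 : 0 < det2 a b q)
    (hg : det2 g b c < 0 ∨ det2 a g c < 0 ∨ det2 a b g < 0) :
    ∃ l : ℝ, 0 < l ∧ l < 1 ∧ ((lp l q g = a ∨ lp l q g = b ∨ lp l q g = c) ∨
      (det2 g b c < 0 ∧ lp l q g ∈ openSegment ℝ b c) ∨
      (det2 a g c < 0 ∧ lp l q g ∈ openSegment ℝ a c) ∨
      (det2 a b g < 0 ∧ lp l q g ∈ openSegment ℝ a b)) := by
  have side : ∀ a b c x : Pt, 0 < det2 a b c → det2 x b c = 0 → 0 ≤ det2 a x c →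
      0 ≤ det2 a b x → x = b ∨ x = c ∨ x ∈ openSegment ℝ b c := by
    intro a b c x hD h1 h2 h3
    have hx := on_side hD h1
    have hs := dsum a b c x
    rcases h3.eq_or_lt with h | h
    · left; rw [← h] at hx; rw [hx]; ext <;> simp [lp]
    rcases h2.eq_or_lt with h' | h'
    · right; left
      have : det2 a b x / det2 a b c = 1 := by rw [div_eq_one_iff_eq hD.ne']; linarith
      rw [this] at hx; rw [hx]; ext <;> simp [lp]
    · right; right
      rw [mem_open_iff]
      exact ⟨_, by positivity, by rw [div_lt_one hD]; linarith, hx⟩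
  obtain ⟨i, l, hi, h0, h1, hz, hnn⟩ := exit3 ![det2 q b c, det2 a q c, det2 a b q]
    ![det2 g b c, det2 a g c, det2 a b g]
    (by intro i; fin_cases i <;> simp <;> linarith)
    (by intro i; fin_cases i <;> simp <;> first | exact q1' | (intro; assumption))
    (by rcases hg with h | h | h
        · exact ⟨0, h⟩
        · exact ⟨1, h⟩
        · exact ⟨2, h⟩)
  have n0 := hnn 0
  have n1 := hnn 1
  have n2 := hnn 2
  simp only [Matrix.cons_val_zero, Matrix.cons_val_one, Matrix.cons_val] at n0 n1 n2
  rw [← d1] at n0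
  rw [← d2] at n1
  rw [← d3] at n2
  refine ⟨l, h0, h1, ?_⟩
  fin_cases i <;> simp at hi hz
  · rw [← d1] at hz
    have := side a b c _ hD hz n1 n2
    tauto
  · rw [← d2] at hz
    have := side b c a (lp l q g) (by rw [← dcyc]; exact hD) (by rw [← dcyc]; exact hz)
      (by rw [← dcyc]; exact n2) (by rw [← dcyc]; exact n0)
    rw [openSegment_symm] at this
    tauto
  · rw [← d3] at hz
    have := side c a b (lp l q g) (by rw [dcyc]; exact hD) (by rw [dcyc]; exact hz)
      (by rw [dcyc]; exact n0) (by rw [dcyc]; exact n1)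
    tauto

variable {V : Type} {p : V → Pt} {T : SimpleGraph V}

def GP (p : V → Pt) : Prop := ∀ u v w : V, u ≠ v → u ≠ w → v ≠ w → det2 (p u) (p v) (p w) ≠ 0

lemma gp_of (hn : GenPos p) : GP p := by
  intro u v w huv huw hvw h
  apply hn.2 u v w huv huw hvw
  rw [collinear_iff_of_mem (p₀ := p u) (by simp)]
  have hne : p u ≠ p v := fun h => huv (hn.1 h)
  refine ⟨p v - p u, ?_⟩
  have hw : ∃ r : ℝ, p w = r • (p v - p u) +ᵥ p u := by
    unfold det2 at h
    by_cases h1 : (p v).1 - (p u).1 = 0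
    · have h2 : (p v).2 - (p u).2 ≠ 0 := fun h2 => hne (by ext <;> linarith)
      refine ⟨((p w).2 - (p u).2) / ((p v).2 - (p u).2), ?_⟩
      ext <;> simp <;> field_simp <;> linarith
    · refine ⟨((p w).1 - (p u).1) / ((p v).1 - (p u).1), ?_⟩
      ext <;> simp <;> field_simp <;> linarith
  intro x hx
  simp only [Set.mem_insert_iff, Set.mem_singleton_iff] at hx
  rcases hx with rfl | rfl | rfl
  · exact ⟨0, by simp⟩
  · exact ⟨1, by simp⟩
  · exact hw

structure MaxPlane (p : V → Pt) (T : SimpleGraph V) : Prop where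
  inj : Function.Injective p
  gp : GP p
  pl : ∀ a b c d, T.Adj a b → T.Adj c d → SegCross (p a) (p b) (p c) (p d) → s(a, b) = s(c, d)
  mx : ∀ a b, a ≠ b → ¬ T.Adj a b → ∃ c d, T.Adj c d ∧ SegCross (p a) (p b) (p c) (p d)

lemma vert_not_open (hinj : Function.Injective p) (hgp : GP p) {a g h : V} (hgh : g ≠ h)
    {t : ℝ} (h0 : 0 < t) (h1 : t < 1) : lp t (p g) (p h) ≠ p a := by
  intro e
  have hne : p g ≠ p h := fun h => hgh (hinj h)
  have e1 : (lp t (p g) (p h)).1 = (p a).1 := by rw [e]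
  have e2 : (lp t (p g) (p h)).2 = (p a).2 := by rw [e]
  simp only [lp] at e1 e2
  by_cases hag : a = g
  · subst hag
    apply hne
    ext
    · have : t * ((p a).1 - (p h).1) = 0 := by linarith
      rcases mul_eq_zero.1 this with h | h <;> linarith
    · have : t * ((p a).2 - (p h).2) = 0 := by linarith
      rcases mul_eq_zero.1 this with h | h <;> linarith
  by_cases hah : a = h
  · subst hah
    apply hne
    ext
    · have : (1 - t) * ((p g).1 - (p a).1) = 0 := by linarith
      rcases mul_eq_zero.1 this with h | h <;> linarith
    · have : (1 - t) * ((p g).2 - (p a).2) = 0 := by linarith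
      rcases mul_eq_zero.1 this with h | h <;> linarith
  apply hgp g h a hgh (Ne.symm hag) (Ne.symm hah)
  rw [← e, d3]; simp

lemma MaxPlane.vExit (M : MaxPlane p T) {a b c g h : V} {q : Pt} {t : ℝ} (hgh : g ≠ h)
    (ht0 : 0 < t) (ht1 : t < 1) (hq : q = lp t (p g) (p h))
    (hD : 0 < det2 (p a) (p b) (p c)) (q1 : 0 ≤ det2 q (p b) (p c))
    (q1' : det2 (p g) (p b) (p c) < 0 → 0 < det2 q (p b) (p c))
    (q2 : 0 < det2 (p a) q (p c)) (q3 : 0 < det2 (p a) (p b) q)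
    (hga : g ≠ a) (hgb : g ≠ b) (hgc : g ≠ c) :
    (0 < det2 (p g) (p b) (p c) ∧ 0 < det2 (p a) (p g) (p c) ∧ 0 < det2 (p a) (p b) (p g)) ∨
    (det2 (p g) (p b) (p c) < 0 ∧ SegCross (p g) (p h) (p b) (p c)) ∨
    (det2 (p a) (p g) (p c) < 0 ∧ SegCross (p g) (p h) (p a) (p c)) ∨
    (det2 (p a) (p b) (p g) < 0 ∧ SegCross (p g) (p h) (p a) (p b)) := by
  have hab : a ≠ b := by rintro rfl; simp at hD
  have hac : a ≠ c := by rintro rfl; simp at hD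
  have hbc : b ≠ c := by rintro rfl; simp at hD
  have n1 := M.gp g b c hgb hgc hbc
  have n2 := M.gp a g c hga.symm hac hgc
  have n3 := M.gp a b g hab hga.symm hgb.symm
  by_cases hg : det2 (p g) (p b) (p c) < 0 ∨ det2 (p a) (p g) (p c) < 0 ∨
    det2 (p a) (p b) (p g) < 0
  · right
    obtain ⟨l, h0, h1, hh⟩ := triExit (p a) (p b) (p c) q (p g) hD q1 q1' q2 q3 hg
    rw [hq, lp_lp1] at hh
    have hl0 : 0 < (1 - l) * t := mul_pos (by linarith) ht0
    have hl1 : (1 - l) * t < 1 := by nlinarith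
    have ho : lp ((1 - l) * t) (p g) (p h) ∈ openSegment ℝ (p g) (p h) :=
      (mem_open_iff _ _ _).2 ⟨_, hl0, hl1, rfl⟩
    rcases hh with (e | e | e) | ⟨e, e'⟩ | ⟨e, e'⟩ | ⟨e, e'⟩
    · exact absurd e (vert_not_open M.inj M.gp hgh hl0 hl1)
    · exact absurd e (vert_not_open M.inj M.gp hgh hl0 hl1)
    · exact absurd e (vert_not_open M.inj M.gp hgh hl0 hl1)
    · exact Or.inl ⟨e, _, ho, e'⟩
    · exact Or.inr (Or.inl ⟨e, _, ho, e'⟩)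
    · exact Or.inr (Or.inr ⟨e, _, ho, e'⟩)
  · push Not at hg
    left
    exact ⟨lt_of_le_of_ne hg.1 n1.symm, lt_of_le_of_ne hg.2.1 n2.symm,
      lt_of_le_of_ne hg.2.2 n3.symm⟩


section

def Emp (p : V → Pt) (a b c : V) : Prop := ∀ z, ¬ (0 < det2 (p z) (p b) (p c) ∧
  0 < det2 (p a) (p z) (p c) ∧ 0 < det2 (p a) (p b) (p z))

lemma Emp.cyc {a b c : V} (h : Emp p a b c) : Emp p b c a := by
  intro z hz
  refine h z ⟨?_, ?_, ?_⟩
  · rw [dcyc]; exact hz.2.2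
  · rw [dcyc]; exact hz.1
  · rw [dcyc]; exact hz.2.1

lemma on_line_edge (M : MaxPlane p T) {u z c d : V} {t : ℝ} (huz : u ≠ z) (hcd : T.Adj c d)
    (ht0 : 0 < t) (h : det2 (p u) (p z) (lp t (p c) (p d)) = 0) (hc : c = u ∨ c = z) :
    T.Adj u z := by
  have hd : d = u ∨ d = z := by
    by_contra hd
    push Not at hd
    have := M.gp u z d huz hd.1.symm hd.2.symm
    rw [d3] at h
    rcases hc with rfl | rfl <;> simp [this, ht0.ne'] at h
  have hne := hcd.ne
  rcases hc with rfl | rfl <;> rcases hd with rfl | rfl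
  · exact absurd rfl hne
  · exact hcd
  · exact hcd.symm
  · exact absurd rfl hne

lemma sne {a b c d : V} (h1 : a ≠ c) (h2 : a ≠ d) : s(a, b) ≠ s(c, d) := by
  intro h
  rw [Sym2.eq_iff] at h
  rcases h with h | h
  · exact h1 h.1
  · exact h2 h.1

variable [Fintype V]

lemma MaxPlane.triK (M : MaxPlane p T) {v a b : V} (hD : 0 < det2 (p v) (p a) (p b))
    (hva : T.Adj v a) (hvb : T.Adj v b)
    (hcone : ∀ y, T.Adj v y → ¬ (0 < det2 (p v) (p y) (p b) ∧ 0 < det2 (p v) (p a) (p y))) :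
    T.Adj a b ∧ Emp p v a b := by
  have hab : a ≠ b := by rintro rfl; simp at hD
  have hE : Emp p v a b := by
    intro z0 hz0
    obtain ⟨z, hz, hmax⟩ := Finset.exists_max_image
      (Finset.univ.filter fun z => 0 < det2 (p z) (p a) (p b) ∧
        0 < det2 (p v) (p z) (p b) ∧ 0 < det2 (p v) (p a) (p z))
      (fun z => det2 (p z) (p a) (p b)) ⟨z0, by simpa using hz0⟩
    simp only [Finset.mem_filter, Finset.mem_univ, true_and] at hz hmax
    obtain ⟨z1, z2, z3⟩ := hz
    have hvz : v ≠ z := by rintro rfl; simp at z2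
    by_cases hT : T.Adj v z
    · exact hcone z hT ⟨z2, z3⟩
    obtain ⟨c, d, hcd, hX⟩ := M.mx v z hvz hT
    obtain ⟨m, t, m0, m1, t0, t1, e⟩ := (segCross_iff _ _ _ _).1 hX
    have key : ∀ (g h : V) (t : ℝ), T.Adj g h → 0 < t → t < 1 →
        lp m (p v) (p z) = lp t (p g) (p h) →
        det2 (lp m (p v) (p z)) (p a) (p b) ≤ det2 (p g) (p a) (p b) → False := by
      intro g h t hgh t0 t1 e hle
      have hlt : det2 (p z) (p a) (p b) < det2 (lp m (p v) (p z)) (p a) (p b) := by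
        have hs := dsum (p v) (p a) (p b) (p z)
        rw [d1]; nlinarith
      by_cases hgv : g = v
      · exact hT (on_line_edge M hvz hgh t0 (by rw [← e, d3]; simp) (Or.inl hgv))
      have hga : g ≠ a := by rintro rfl; simp at hle; linarith
      have hgb : g ≠ b := by rintro rfl; simp at hle; linarith
      have := M.vExit hgh.ne t0 t1 e hD (by linarith) (by intro; linarith)
        (by rw [d2]; simp; positivity) (by rw [d3]; simp; positivity) hgv hga hgb
      rcases this with h1 | h1 | h1 | h1
      · have := hmax g h1; linarith
      · linarith [h1.1]
      · exact sne hgv hgb (M.pl _ _ _ _ hgh hvb h1.2)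
      · exact sne hgv hga (M.pl _ _ _ _ hgh hva h1.2)
    have hor : det2 (lp m (p v) (p z)) (p a) (p b) ≤ det2 (p c) (p a) (p b) ∨
        det2 (lp m (p v) (p z)) (p a) (p b) ≤ det2 (p d) (p a) (p b) := by
      rw [e, d1]
      by_contra hh
      push Not at hh
      nlinarith [hh.1, hh.2]
    rcases hor with h | h
    · exact key c d t hcd t0 t1 e h
    · exact key d c (1 - t) hcd.symm (by linarith) (by linarith) (by rw [e, lp_symm]) h
  refine ⟨?_, hE⟩
  by_contra hT
  obtain ⟨c, d, hcd, hX⟩ := M.mx a b hab hT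
  obtain ⟨m, t, m0, m1, t0, t1, e⟩ := (segCross_iff _ _ _ _).1 hX
  have key : ∀ (g h : V) (t : ℝ), T.Adj g h → 0 < t → t < 1 →
      lp m (p a) (p b) = lp t (p g) (p h) → 0 ≤ det2 (p g) (p a) (p b) → False := by
    intro g h t hgh t0 t1 e hle
    have q2 : 0 < det2 (p v) (lp m (p a) (p b)) (p b) := by
      rw [d2]; simp; nlinarith
    have q3 : 0 < det2 (p v) (p a) (lp m (p a) (p b)) := by
      rw [d3]; simp; positivity
    have hga : g ≠ a := fun hh =>
      hT (on_line_edge M hab hgh t0 (by rw [← e, d3]; simp) (Or.inl hh))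
    have hgb : g ≠ b := fun hh =>
      hT (on_line_edge M hab hgh t0 (by rw [← e, d3]; simp) (Or.inr hh))
    have hpos : 0 < det2 (p g) (p a) (p b) := lt_of_le_of_ne hle (M.gp g a b hga hgb hab).symm
    by_cases hgv : g = v
    · subst hgv
      rw [e, d2] at q2
      rw [e, d3] at q3
      simp only [daa, dab, mul_zero, zero_add] at q2 q3
      exact hcone h hgh ⟨pos_of_mul_pos_right q2 t0.le, pos_of_mul_pos_right q3 t0.le⟩
    have := M.vExit hgh.ne t0 t1 e hD (by rw [d1]; simp) (by intro; linarith)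
        q2 q3 hgv hga hgb
    rcases this with h1 | h1 | h1 | h1
    · exact hE g h1
    · linarith [h1.1]
    · exact sne hgv hgb (M.pl _ _ _ _ hgh hvb h1.2)
    · exact sne hgv hga (M.pl _ _ _ _ hgh hva h1.2)
  have hor : 0 ≤ det2 (p c) (p a) (p b) ∨ 0 ≤ det2 (p d) (p a) (p b) := by
    have h0 : det2 (lp t (p c) (p d)) (p a) (p b) = 0 := by rw [← e, d1]; simp
    rw [d1] at h0
    by_contra hh
    push Not at hh
    nlinarith [hh.1, hh.2]
  rcases hor with h | h
  · exact key c d t hcd t0 t1 e h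
  · exact key d c (1 - t) hcd.symm (by linarith) (by linarith) (by rw [e, lp_symm]) h

/-- No neighbour of `a` in the open cone of an empty triangle. -/
lemma MaxPlane.coneEmpty (M : MaxPlane p T) {a b c : V} (hD : 0 < det2 (p a) (p b) (p c))
    (hbc : T.Adj b c) (hE : Emp p a b c) (y : V) (hy : T.Adj a y) :
    ¬ (0 < det2 (p a) (p y) (p c) ∧ 0 < det2 (p a) (p b) (p y)) := by
  rintro ⟨h1, h2⟩
  have hab : a ≠ b := by rintro rfl; simp at hD
  have hac : a ≠ c := by rintro rfl; simp at hD
  have hyb : y ≠ b := by rintro rfl; simp at h2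
  have hyc : y ≠ c := by rintro rfl; simp at h1
  have hα : det2 (p y) (p b) (p c) < 0 := by
    by_contra hh
    exact hE y ⟨lt_of_le_of_ne (not_lt.1 hh) (M.gp y b c hyb hyc hbc.ne).symm, h1, h2⟩
  have hs := dsum (p a) (p b) (p c) (p y)
  set D := det2 (p a) (p b) (p c) with hDd
  set α := det2 (p y) (p b) (p c) with hαd
  have l0 : 0 < D / (D - α) := div_pos hD (by linarith)
  have l1 : D / (D - α) < 1 := by rw [div_lt_one (by linarith)]; linarith
  have hz : det2 (lp (D / (D - α)) (p a) (p y)) (p b) (p c) = 0 := by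
    rw [d1, ← hDd, ← hαd]
    have : D - α ≠ 0 := by linarith
    field_simp; ring
  have hx := on_side hD hz
  have hγ : det2 (p a) (p b) (lp (D / (D - α)) (p a) (p y)) =
    D / (D - α) * det2 (p a) (p b) (p y) := by rw [d3]; simp
  have hβ : det2 (p a) (lp (D / (D - α)) (p a) (p y)) (p c) =
    D / (D - α) * det2 (p a) (p y) (p c) := by rw [d2]; simp
  have hs2 := dsum (p a) (p b) (p c) (lp (D / (D - α)) (p a) (p y))
  have g0 : 0 < det2 (p a) (p b) (lp (D / (D - α)) (p a) (p y)) := by rw [hγ]; positivity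
  have b0 : 0 < det2 (p a) (lp (D / (D - α)) (p a) (p y)) (p c) := by rw [hβ]; positivity
  have : SegCross (p a) (p y) (p b) (p c) := (segCross_iff _ _ _ _).2
    ⟨_, _, l0, l1, div_pos g0 hD, by rw [div_lt_one hD]; linarith, hx⟩
  exact sne hab hac (M.pl _ _ _ _ hy hbc this)

lemma cross_of_signs {u v w x : Pt} (h1 : 0 < det2 u v w) (h2 : det2 u v x < 0)
    (h3 : 0 < det2 v w x) (h4 : det2 u w x < 0) : SegCross u v w x := by
  set m := det2 u v w / (det2 u v w - det2 u v x) with hm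
  have m0 : 0 < m := div_pos h1 (by linarith)
  have m1 : m < 1 := by rw [hm, div_lt_one (by linarith)]; linarith
  have hz : det2 u v (lp m w x) = 0 := by
    rw [d3, hm]
    have : det2 u v w - det2 u v x ≠ 0 := by linarith
    field_simp; ring
  have hD : 0 < det2 w u v := by rw [dcyc]; exact h1
  have hx := on_side hD (x := lp m w x) (by rw [dcyc]; exact hz)
  have a1 : 0 < det2 w (lp m w x) v := by
    rw [d2, dcyc w x v, dcyc x v w]; simp; positivity
  have a2 : 0 < det2 w u (lp m w x) := by
    rw [d3, dsw w u x]; simp; nlinarith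
  have hs := dsum w u v (lp m w x)
  rw [dcyc (lp m w x) u v, hz] at hs
  exact segCross_comm ((segCross_iff _ _ _ _).2 ⟨m, _, m0, m1, div_pos a2 hD,
    by rw [div_lt_one hD]; linarith, hx⟩)

lemma MaxPlane.flip (M : MaxPlane p T) {u v w x : V}
    (h1 : 0 < det2 (p u) (p v) (p w)) (h2 : det2 (p u) (p v) (p x) < 0)
    (h3 : 0 < det2 (p v) (p w) (p x)) (h4 : det2 (p u) (p w) (p x) < 0)
    (huv : T.Adj u v) (huw : T.Adj u w) (hvw : T.Adj v w) (hux : T.Adj u x) (hvx : T.Adj v x)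
    (hE1 : Emp p u v w) (hE2 : Emp p v u x) {g h : V} (hgh : T.Adj g h)
    (hX : SegCross (p w) (p x) (p g) (p h)) : s(g, h) = s(u, v) := by
  have hXuv := cross_of_signs h1 h2 h3 h4
  have hwx : w ≠ x := by rintro rfl; simp at h3
  have hnwx : ¬ T.Adj w x := by
    intro hT
    exact sne huw.ne hux.ne (M.pl _ _ _ _ huv hT hXuv)
  obtain ⟨m, t, m0, m1, t0, t1, e⟩ := (segCross_iff _ _ _ _).1 hX
  -- generic half
  have half : ∀ (u v w x : V) (m : ℝ), 0 < det2 (p u) (p v) (p w) → 0 < m →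
      0 < det2 (p v) (p w) (p x) → det2 (p u) (p w) (p x) < 0 → T.Adj u v → T.Adj u w →
      T.Adj v w → Emp p u v w → w ≠ x → u ≠ x → v ≠ x → ¬ T.Adj w x →
      lp m (p w) (p x) = lp t (p g) (p h) → 0 < det2 (p u) (p v) (lp m (p w) (p x)) →
      s(g, h) = s(u, v) := by
    intro u v w x m h1 m0 h3 h4 huv huw hvw hE hwx hux hvx hnwx e hq
    have hD' : det2 (p x) (p v) (p w) = det2 (p v) (p w) (p x) := by rw [dcyc]
    have hD'' : det2 (p u) (p x) (p w) = - det2 (p u) (p w) (p x) := by rw [dsw2]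
    have q1 : 0 < det2 (lp m (p w) (p x)) (p v) (p w) := by
      rw [d1, hD']; simp; positivity
    have q2 : 0 < det2 (p u) (lp m (p w) (p x)) (p w) := by
      rw [d2, hD'']; simp; nlinarith
    have key : ∀ (g h : V) (t : ℝ), T.Adj g h → 0 < t → t < 1 →
        lp m (p w) (p x) = lp t (p g) (p h) → g = u ∨ g = v := by
      intro g h t hgh t0 t1 e
      by_contra hne
      push Not at hne
      by_cases hgw : g = w
      · exact hnwx (on_line_edge M hwx hgh t0 (by rw [← e, d3]; simp) (Or.inl hgw))
      rcases M.vExit hgh.ne t0 t1 e h1 q1.le (fun _ => q1) q2 hq hne.1 hne.2 hgw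
        with h1 | h1 | h1 | h1
      · exact hE g h1
      · exact sne hne.2 hgw (M.pl _ _ _ _ hgh hvw h1.2)
      · exact sne hne.1 hgw (M.pl _ _ _ _ hgh huw h1.2)
      · exact sne hne.1 hne.2 (M.pl _ _ _ _ hgh huv h1.2)
    have k1 := key g h t hgh t0 t1 e
    have k2 := key h g (1 - t) hgh.symm (by linarith) (by linarith) (by rw [e, lp_symm])
    have := hgh.ne
    rw [Sym2.eq_iff]
    rcases k1 with rfl | rfl <;> rcases k2 with rfl | rfl <;> simp_all
  rcases lt_trichotomy (det2 (p u) (p v) (lp m (p w) (p x))) 0 with hq | hq | hq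
  · have := half v u x w (1 - m) (by rw [dsw]; linarith) (by linarith)
      (by rw [dsw2]; linarith) (by rw [dsw2]; linarith) huv.symm hvx hux hE2 hwx.symm
      hvw.ne huw.ne (fun h => hnwx h.symm) (by rw [← e, ← lp_symm])
      (by rw [← lp_symm, dsw]; linarith)
    rw [this, Sym2.eq_swap]
  · apply M.pl _ _ _ _ hgh huv
    have hD : 0 < det2 (p w) (p u) (p v) := by rw [dcyc]; exact h1
    have hx := on_side hD (x := lp m (p w) (p x)) (by rw [dcyc]; exact hq)
    have a1 : 0 < det2 (p w) (lp m (p w) (p x)) (p v) := by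
      rw [d2, dcyc (p w) (p x) (p v), dcyc (p x) (p v) (p w)]; simp; positivity
    have a2 : 0 < det2 (p w) (p u) (lp m (p w) (p x)) := by
      rw [d3, dsw (p w) (p u) (p x)]; simp; nlinarith
    have hs := dsum (p w) (p u) (p v) (lp m (p w) (p x))
    rw [dcyc (lp m (p w) (p x)) (p u) (p v), hq] at hs
    exact (segCross_iff _ _ _ _).2 ⟨t, _, t0, t1, div_pos a2 hD,
      by rw [div_lt_one hD]; linarith, e.symm.trans hx⟩
  · exact half u v w x m h1 m0 h3 h4 huv huw hvw hE1 hwx hux.ne hvx.ne hnwx e hq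


end

lemma argmax {V : Type} (W : Finset V) (hW : W.Nonempty) (s m : V → ℝ) (hm : ∀ w ∈ W, 0 < m w) :
    ∃ w ∈ W, ∀ y ∈ W, s y * m w ≤ s w * m y := by
  obtain ⟨w, hw, h⟩ := Finset.exists_max_image W (fun w => s w / m w) hW
  refine ⟨w, hw, fun y hy => ?_⟩
  have := h y hy
  rwa [div_le_div_iff₀ (hm y hy) (hm w hw)] at this

lemma basis_id (u q c x : Pt) (h : det2 u q c ≠ 0) :
    x.1 = u.1 + (det2 u x c / det2 u q c) * (q.1 - u.1) + (det2 u q x / det2 u q c) * (c.1 - u.1) ∧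
    x.2 = u.2 + (det2 u x c / det2 u q c) * (q.2 - u.2) + (det2 u q x / det2 u q c) * (c.2 - u.2) := by
  have e1 : det2 u q c * (x.1 - u.1) = det2 u x c * (q.1 - u.1) + det2 u q x * (c.1 - u.1) := by
    simp [det2]; ring
  have e2 : det2 u q c * (x.2 - u.2) = det2 u x c * (q.2 - u.2) + det2 u q x * (c.2 - u.2) := by
    simp [det2]; ring
  constructor <;> field_simp <;> linarith

set_option maxHeartbeats 2000000 in
/-- Half-plane lemma: core. -/
lemma MaxPlane.half_core (M : MaxPlane p T) [Fintype V] (A B : ℝ) {u z c d : V} {t τ : ℝ}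
    (huz : u ≠ z) (hnT : ¬ T.Adj u z) (hcd : T.Adj c d)
    (t0 : 0 < t) (t1 : t < 1) (τ0 : 0 < τ) (τ1 : τ < 1)
    (e : lp t (p u) (p z) = lp τ (p c) (p d))
    (hmin : ∀ (g h : V) (t' ν : ℝ), T.Adj g h → 0 < t' → t' < 1 → 0 < ν → ν < 1 →
      lp t' (p u) (p z) = lp ν (p g) (p h) → t ≤ t')
    (hq : A * (p u).1 + B * (p u).2 <
      A * (lp t (p u) (p z)).1 + B * (lp t (p u) (p z)).2)
    (hc : A * (lp t (p u) (p z)).1 + B * (lp t (p u) (p z)).2 ≤ A * (p c).1 + B * (p c).2) :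
    ∃ w, T.Adj u w ∧ A * (p u).1 + B * (p u).2 < A * (p w).1 + B * (p w).2 := by
  have hcuz : c ≠ u ∧ c ≠ z := by
    constructor <;> intro hh <;> apply hnT <;>
      apply on_line_edge M huz hcd τ0 (by rw [← e, d3]; simp) <;> tauto
  set q := lp t (p u) (p z) with hqd
  have hDt : det2 (p u) q (p c) = t * det2 (p u) (p z) (p c) := by rw [hqd, d2]; simp
  have hΔ : det2 (p u) q (p c) ≠ 0 := by
    rw [hDt]
    exact mul_ne_zero t0.ne' (M.gp u z c huz hcuz.1.symm hcuz.2.symm)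
  set Δ := det2 (p u) q (p c) with hΔd
  obtain ⟨s, hs⟩ : ∃ s : Pt → ℝ, s = fun x => det2 (p u) x (p c) / Δ := ⟨_, rfl⟩
  obtain ⟨m, hm⟩ : ∃ m : Pt → ℝ, m = fun x => det2 (p u) q x / Δ := ⟨_, rfl⟩
  have slin : ∀ l x y, s (lp l x y) = (1 - l) * s x + l * s y := by
    intro l x y; simp only [hs, d2]; ring
  have mlin : ∀ l x y, m (lp l x y) = (1 - l) * m x + l * m y := by
    intro l x y; simp only [hm, d3]; ring
  have bas : ∀ x : Pt, x.1 = (p u).1 + s x * (q.1 - (p u).1) + m x * ((p c).1 - (p u).1) ∧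
      x.2 = (p u).2 + s x * (q.2 - (p u).2) + m x * ((p c).2 - (p u).2) := by
    intro x; simp only [hs, hm]; exact basis_id (p u) q (p c) x hΔ
  have su : s (p u) = 0 := by simp [hs]
  have mu : m (p u) = 0 := by simp [hm]
  have sq : s q = 1 := by simp only [hs]; exact div_self hΔ
  have mq : m q = 0 := by simp [hm]
  have sc : s (p c) = 0 := by simp [hs]
  have mc : m (p c) = 1 := by simp only [hm]; exact div_self hΔ
  clear_value q
  have sumd : s (p d) + m (p d) = 1 := by
    have h1 := slin τ (p c) (p d)
    have h2 := mlin τ (p c) (p d)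
    rw [← e, sq, sc] at h1
    rw [← e, mq, mc] at h2
    have : τ * (s (p d) + m (p d) - 1) = 0 := by linarith
    rcases mul_eq_zero.1 this with h | h <;> linarith
  have sz : t * s (p z) = 1 := by
    have h1 := slin t (p u) (p z)
    rw [← hqd, sq, su] at h1; linarith
  have sz1 : 1 < s (p z) := by
    have : 0 < s (p z) := by
      by_contra h
      have := mul_nonpos_of_nonneg_of_nonpos t0.le (not_lt.1 h)
      linarith
    nlinarith
  have mz : m (p z) = 0 := by
    have h1 := mlin t (p u) (p z)
    rw [← hqd, mq, mu] at h1
    have : t * m (p z) = 0 := by linarith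
    rcases mul_eq_zero.1 this with h | h <;> linarith
  have hmzero : ∀ g : V, m (p g) = 0 → g = u ∨ g = z := by
    intro g hg
    by_contra hh
    push Not at hh
    have h1 : det2 (p u) q (p g) = 0 := by
      simp only [hm] at hg
      rcases div_eq_zero_iff.1 hg with h | h
      · exact h
      · exact absurd h hΔ
    rw [hqd, d2] at h1
    simp only [daa, mul_zero, zero_add] at h1
    rcases mul_eq_zero.1 h1 with h | h
    · linarith
    · exact M.gp u z g huz hh.1.symm hh.2.symm h
  have hdet : ∀ x y : Pt, det2 (p u) x y = (s x * m y - m x * s y) * Δ := by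
    intro x y
    obtain ⟨x1, x2⟩ := bas x
    obtain ⟨y1, y2⟩ := bas y
    rw [hΔd]
    simp only [det2]
    rw [x1, x2, y1, y2]
    ring
  -- choose w
  obtain ⟨w, hw, hwmax⟩ := argmax
    (Finset.univ.filter fun w : V => 0 ≤ s (p w) ∧ 0 < m (p w) ∧ s (p w) + m (p w) ≤ 1)
    ⟨c, by simp [sc, mc]⟩ (fun w => s (p w)) (fun w => m (p w))
    (by intro w hw; simp only [Finset.mem_filter] at hw; exact hw.2.2.1)
  simp only [Finset.mem_filter, Finset.mem_univ, true_and] at hw hwmax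
  obtain ⟨w1, w2, w3⟩ := hw
  refine ⟨w, ?_, ?_⟩
  swap
  · obtain ⟨x1, x2⟩ := bas (p w)
    rw [x1, x2]
    have h1 : 0 ≤ s (p w) * (A * q.1 + B * q.2 - (A * (p u).1 + B * (p u).2)) :=
      mul_nonneg w1 (by linarith)
    have h2 : 0 < m (p w) * (A * (p c).1 + B * (p c).2 - (A * (p u).1 + B * (p u).2)) :=
      mul_pos w2 (by linarith)
    nlinarith
  by_contra hnw
  have huw : u ≠ w := by rintro rfl; linarith
  obtain ⟨g, h, hgh, hX⟩ := M.mx u w huw hnw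
  obtain ⟨μ, ν, μ0, μ1, ν0, ν1, er⟩ := (segCross_iff _ _ _ _).1 hX
  have key : ∀ (g h : V) (ν : ℝ), T.Adj g h → 0 < ν → ν < 1 →
      lp μ (p u) (p w) = lp ν (p g) (p h) →
      0 < s (p g) * m (p w) - m (p g) * s (p w) → False := by
    intro g h ν hgh ν0 ν1 er hκ
    set r := lp μ (p u) (p w) with hr
    have sr : s r = μ * s (p w) := by rw [hr, slin, su]; ring
    have mr : m r = μ * m (p w) := by rw [hr, mlin, mu]; ring
    have sr0 : 0 ≤ s r := by rw [sr]; positivity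
    have mr0 : 0 < m r := by rw [mr]; positivity
    have sumr : s r + m r < 1 := by rw [sr, mr]; nlinarith
    have hgu : g ≠ u := by
      rintro rfl; rw [su, mu] at hκ; linarith
    have inW : m (p g) > 0 → 1 < s (p g) + m (p g) := by
      intro hmg
      by_contra hh
      have hsg : 0 ≤ s (p g) := by
        by_contra hneg
        have : s (p g) * m (p w) < 0 := mul_neg_of_neg_of_pos (not_le.1 hneg) w2
        have : 0 ≤ m (p g) * s (p w) := mul_nonneg hmg.le w1
        linarith
      have := hwmax g ⟨hsg, hmg, not_lt.1 hh⟩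
      linarith
    -- crossing cd is impossible
    have crosscd : ∀ l : ℝ, 0 < l → l < 1 → s (lp l r (p g)) + m (lp l r (p g)) = 1 →
        0 < s (lp l r (p g)) → 0 ≤ m (lp l r (p g)) → False := by
      intro l l0 l1 h1 h2 h3
      set y := lp l r (p g) with hy
      have ey : y = lp (m y) q (p c) := by
        obtain ⟨y1, y2⟩ := bas y
        have : s y = 1 - m y := by linarith
        rw [this] at y1 y2
        ext
        · simp only [lp]; linarith
        · simp only [lp]; linarith
      rw [e, lp_lp1] at ey
      have ey2 := hy
      rw [er, lp_lp1] at ey2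
      have hc1 : SegCross (p g) (p h) (p c) (p d) := (segCross_iff _ _ _ _).2
        ⟨(1 - l) * ν, (1 - m y) * τ, mul_pos (by linarith) ν0, by nlinarith,
          mul_pos (by linarith) τ0, by nlinarith, by rw [← ey, ← ey2]⟩
      have := M.pl _ _ _ _ hgh hcd hc1
      rw [Sym2.eq_iff] at this
      have sr' := slin ν (p g) (p h)
      have mr' := mlin ν (p g) (p h)
      rw [← er] at sr' mr'
      rcases this with ⟨rfl, rfl⟩ | ⟨rfl, rfl⟩
      · rw [sc] at sr'; rw [mc] at mr'
        have : ν * (s (p h) + m (p h)) = ν := by rw [sumd, mul_one]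
        linarith
      · rw [sc] at sr'; rw [mc] at mr'
        have : (1 - ν) * (s (p g) + m (p g)) = 1 - ν := by rw [sumd, mul_one]
        linarith
    rcases le_or_gt 0 (m (p g)) with hmg | hmg
    · have hsum : 1 < s (p g) + m (p g) := by
        rcases hmg.eq_or_lt with h0 | h0
        · rcases hmzero g h0.symm with h | h
          · exact absurd h hgu
          · rw [h]; linarith
        · exact inW h0
      have hsg : 0 < s (p g) := by
        have : 0 ≤ m (p g) * s (p w) := mul_nonneg hmg w1
        exact pos_of_mul_pos_left (by linarith : 0 < s (p g) * m (p w)) w2.le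
      set l := (1 - (s r + m r)) / ((s (p g) + m (p g)) - (s r + m r)) with hl
      have hden : 0 < (s (p g) + m (p g)) - (s r + m r) := by linarith
      have l0 : 0 < l := div_pos (by linarith) hden
      have l1 : l < 1 := by rw [hl, div_lt_one hden]; linarith
      have hlm : l * ((s (p g) + m (p g)) - (s r + m r)) = 1 - (s r + m r) := by
        rw [hl]; field_simp
      apply crosscd l l0 l1
      · rw [slin, mlin]; linarith
      · rw [slin]
        have : 0 ≤ (1 - l) * s r := mul_nonneg (by linarith) sr0
        have : 0 < l * s (p g) := mul_pos l0 hsg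
        linarith
      · rw [mlin]
        have : 0 ≤ (1 - l) * m r := mul_nonneg (by linarith) mr0.le
        have : 0 ≤ l * m (p g) := mul_nonneg l0.le hmg
        linarith
    · set l := m r / (m r - m (p g)) with hl
      have hden : 0 < m r - m (p g) := by linarith
      have l0 : 0 < l := div_pos mr0 hden
      have l1 : l < 1 := by rw [hl, div_lt_one hden]; linarith
      have hlm : l * (m r - m (p g)) = m r := by rw [hl]; field_simp
      have my : m (lp l r (p g)) = 0 := by rw [mlin]; linarith
      have sy : 0 < s (lp l r (p g)) := by
        have h1 : s (lp l r (p g)) * m (p w) - m (lp l r (p g)) * s (p w) =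
            l * (s (p g) * m (p w) - m (p g) * s (p w)) := by
          rw [slin, mlin, sr, mr]; ring
        rw [my] at h1
        have h2 : 0 < s (lp l r (p g)) * m (p w) := by
          have := mul_pos l0 hκ
          linarith
        exact pos_of_mul_pos_left h2 w2.le
      rcases lt_or_ge (s (lp l r (p g))) 1 with hs1 | hs1
      · have ey : lp l r (p g) = lp (s (lp l r (p g))) (p u) q := by
          obtain ⟨y1, y2⟩ := bas (lp l r (p g))
          rw [my] at y1 y2
          ext
          · rw [y1]; simp only [lp]; ring
          · rw [y2]; simp only [lp]; ring
        rw [hqd, lp_lp2] at ey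
        have ey2 : lp l r (p g) = lp ((1 - l) * ν) (p g) (p h) := by rw [er, lp_lp1]
        have := hmin g h _ _ hgh (mul_pos sy t0) (by nlinarith)
          (mul_pos (by linarith : 0 < 1 - l) ν0) (by nlinarith) (ey.symm.trans ey2)
        nlinarith
      · set y0 := lp l r (p g) with hy0
        set σ := (1 - (s r + m r)) / (s y0 - (s r + m r)) with hσ
        have hden2 : 0 < s y0 - (s r + m r) := by linarith
        have σ0 : 0 < σ := div_pos (by linarith) hden2
        have σ1 : σ ≤ 1 := by rw [hσ, div_le_one hden2]; linarith
        have hσm : σ * (s y0 - (s r + m r)) = 1 - (s r + m r) := by rw [hσ]; field_simp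
        have hyy : lp σ r y0 = lp (σ * l) r (p g) := by rw [hy0, lp_lp2]
        apply crosscd (σ * l) (by positivity) (by nlinarith)
        · rw [← hyy, slin, mlin, my]; linarith
        · rw [← hyy, slin]
          have : 0 ≤ (1 - σ) * s r := mul_nonneg (by linarith) sr0
          have : 0 < σ * s y0 := by positivity
          linarith
        · rw [← hyy, mlin, my]
          have : 0 ≤ (1 - σ) * m r := mul_nonneg (by linarith) mr0.le
          linarith
  -- conclude
  have hsum : (1 - ν) * (s (p g) * m (p w) - m (p g) * s (p w)) +
      ν * (s (p h) * m (p w) - m (p h) * s (p w)) = 0 := by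
    have h1 : s (lp ν (p g) (p h)) = μ * s (p w) := by rw [← er, slin, su]; ring
    have h2 : m (lp ν (p g) (p h)) = μ * m (p w) := by rw [← er, mlin, mu]; ring
    rw [slin] at h1
    rw [mlin] at h2
    linear_combination m (p w) * h1 - s (p w) * h2
  rcases lt_trichotomy (s (p g) * m (p w) - m (p g) * s (p w)) 0 with hk | hk | hk
  · refine key h g (1 - ν) hgh.symm (by linarith) (by linarith) (by rw [er, lp_symm]) ?_
    have : (1 - ν) * (s (p g) * m (p w) - m (p g) * s (p w)) < 0 :=
      mul_neg_of_pos_of_neg (by linarith) hk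
    exact pos_of_mul_pos_right (by linarith : 0 < ν * _) ν0.le
  · apply hnw
    apply on_line_edge M huw hgh ν0 (by rw [← er, d3]; simp)
    by_contra hne
    push Not at hne
    apply M.gp u w g huw hne.1.symm hne.2.symm
    rw [hdet]
    have : s (p w) * m (p g) - m (p w) * s (p g) = 0 := by linarith
    rw [this, zero_mul]
  · exact key g h ν hgh ν0 ν1 er hk

lemma MaxPlane.half (M : MaxPlane p T) [Fintype V] (A B : ℝ) {u z : V}
    (hz : A * (p u).1 + B * (p u).2 < A * (p z).1 + B * (p z).2) :
    ∃ w, T.Adj u w ∧ A * (p u).1 + B * (p u).2 < A * (p w).1 + B * (p w).2 := by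
  by_cases hT : T.Adj u z
  · exact ⟨z, hT, hz⟩
  have huz : u ≠ z := by rintro rfl; linarith
  obtain ⟨c0, d0, hcd0, hX0⟩ := M.mx u z huz hT
  have par : ∀ (g h : V) (t' ν : ℝ), T.Adj g h → 0 < t' → t' < 1 → 0 < ν → ν < 1 →
      lp t' (p u) (p z) = lp ν (p g) (p h) →
      t' = det2 (p g) (p h) (p u) / (det2 (p g) (p h) (p u) - det2 (p g) (p h) (p z)) := by
    intro g h t' ν hgh t0 t1 ν0 ν1 e
    have h0 : det2 (p g) (p h) (lp t' (p u) (p z)) = 0 := by rw [e, d3]; simp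
    rw [d3] at h0
    have hgu : g ≠ u := fun hh => hT (on_line_edge M huz hgh ν0 (by rw [← e, d3]; simp) (Or.inl hh))
    have hhu : h ≠ u := fun hh => hT (on_line_edge M huz hgh.symm (t := 1 - ν) (by linarith)
      (by rw [← lp_symm, ← e, d3]; simp) (Or.inl hh))
    have hne := M.gp g h u hgh.ne hgu hhu
    have hden : det2 (p g) (p h) (p u) - det2 (p g) (p h) (p z) ≠ 0 := by
      intro h1
      apply hne
      have : det2 (p g) (p h) (p z) = det2 (p g) (p h) (p u) := by linarith
      rw [this] at h0; linarith
    field_simp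
    linarith
  obtain ⟨⟨c, d⟩, hmem, hmin⟩ := Finset.exists_min_image
    (Finset.univ.filter fun x : V × V => T.Adj x.1 x.2 ∧ SegCross (p u) (p z) (p x.1) (p x.2))
    (fun x => det2 (p x.1) (p x.2) (p u) /
      (det2 (p x.1) (p x.2) (p u) - det2 (p x.1) (p x.2) (p z)))
    ⟨(c0, d0), by simpa using ⟨hcd0, hX0⟩⟩
  simp only [Finset.mem_filter, Finset.mem_univ, true_and, Prod.forall] at hmem hmin
  obtain ⟨hcd, hX⟩ := hmem
  obtain ⟨t, τ, t0, t1, τ0, τ1, e⟩ := (segCross_iff _ _ _ _).1 hX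
  have hmin' : ∀ (g h : V) (t' ν : ℝ), T.Adj g h → 0 < t' → t' < 1 → 0 < ν → ν < 1 →
      lp t' (p u) (p z) = lp ν (p g) (p h) → t ≤ t' := by
    intro g h t' ν hgh a1 a2 a3 a4 e'
    rw [par c d t τ hcd t0 t1 τ0 τ1 e, par g h t' ν hgh a1 a2 a3 a4 e']
    exact hmin g h ⟨hgh, (segCross_iff _ _ _ _).2 ⟨t', ν, a1, a2, a3, a4, e'⟩⟩
  have hq : A * (p u).1 + B * (p u).2 <
      A * (lp t (p u) (p z)).1 + B * (lp t (p u) (p z)).2 := by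
    simp only [lp]
    nlinarith
  have hor : A * (lp t (p u) (p z)).1 + B * (lp t (p u) (p z)).2 ≤ A * (p c).1 + B * (p c).2 ∨
      A * (lp t (p u) (p z)).1 + B * (lp t (p u) (p z)).2 ≤ A * (p d).1 + B * (p d).2 := by
    rw [e]
    simp only [lp]
    by_contra hh
    push Not at hh
    nlinarith [hh.1, hh.2]
  rcases hor with h | h
  · exact M.half_core A B huz hT hcd t0 t1 τ0 τ1 e hmin' hq h
  · exact M.half_core A B huz hT hcd.symm t0 t1 (τ := 1 - τ) (by linarith) (by linarith)
      (by rw [e, lp_symm]) hmin' hq h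



def Ext (p : V → Pt) (u : V) : Prop := ∃ A B : ℝ, (A ≠ 0 ∨ B ≠ 0) ∧
  ∀ w, A * (p w).1 + B * (p w).2 ≤ A * (p u).1 + B * (p u).2

lemma exists_theta [Fintype V] (hinj : Function.Injective p) :
    ∃ θ : ℝ, ∀ u v : V, (p u).1 + θ * (p u).2 = (p v).1 + θ * (p v).2 → u = v := by
  obtain ⟨θ, hθ⟩ := Infinite.exists_notMem_finset
    (Finset.univ.image fun x : V × V => -((p x.1).1 - (p x.2).1) / ((p x.1).2 - (p x.2).2))
  refine ⟨θ, fun u v h => ?_⟩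
  by_contra huv
  by_cases h2 : (p u).2 - (p v).2 = 0
  · apply huv
    apply hinj
    have e2 : (p u).2 = (p v).2 := by linarith
    ext
    · rw [e2] at h; linarith
    · exact e2
  · apply hθ
    simp only [Finset.mem_image, Finset.mem_univ, true_and, Prod.exists]
    refine ⟨u, v, ?_⟩
    rw [div_eq_iff h2]; linarith

lemma MaxPlane.nb (M : MaxPlane p T) [Fintype V] (θ : ℝ) {X : V → ℝ}
    (hX : X = fun v => (p v).1 + θ * (p v).2) (sx sy : ℝ) {v z : V}
    (hz : 0 < sx * (X z - X v)) :
    ∃ w, T.Adj v w ∧ 0 < sx * (X w - X v) ∧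
      ∀ y, T.Adj v y → 0 < sx * (X y - X v) → sx * sy * det2 (p v) (p w) (p y) ≤ 0 := by
  obtain ⟨w0, hw0, hw0'⟩ := M.half sx (sx * θ) (u := v) (z := z)
    (by simp only [hX] at hz; linarith)
  obtain ⟨w, hw, hmax⟩ := argmax (Finset.univ.filter fun w => T.Adj v w ∧ 0 < sx * (X w - X v))
    ⟨w0, by simp only [hX, Finset.mem_filter, Finset.mem_univ, true_and]; exact ⟨hw0, by linarith⟩⟩
    (fun w => sy * ((p w).2 - (p v).2)) (fun w => sx * (X w - X v))
    (by intro w hw; simp only [Finset.mem_filter] at hw; exact hw.2.2)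
  simp only [Finset.mem_filter, Finset.mem_univ, true_and] at hw hmax
  refine ⟨w, hw.1, hw.2, fun y hy hy' => ?_⟩
  have := hmax y ⟨hy, hy'⟩
  simp only [hX] at this
  simp only [det2]
  linarith

lemma pluck (v a b y : Pt) (θ : ℝ) :
    ((a.1 + θ * a.2) - (v.1 + θ * v.2)) * det2 v b y -
    ((b.1 + θ * b.2) - (v.1 + θ * v.2)) * det2 v a y +
    ((y.1 + θ * y.2) - (v.1 + θ * v.2)) * det2 v a b = 0 := by
  simp only [det2]; ring

lemma ext_of (M : MaxPlane p T) [Fintype V] {v a : V} (hva : v ≠ a)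
    (h : ∀ y, T.Adj v y → det2 (p v) (p a) (p y) ≤ 0) : Ext p v := by
  refine ⟨-((p a).2 - (p v).2), (p a).1 - (p v).1, ?_, ?_⟩
  · by_contra hh
    push Not at hh
    apply hva
    apply M.inj
    ext <;> linarith [hh.1, hh.2]
  · intro w
    by_contra hw
    push Not at hw
    obtain ⟨y, hy, hy'⟩ := M.half _ _ hw
    have := h y hy
    simp only [det2] at this
    linarith

lemma MaxPlane.countA (M : MaxPlane p T) [Fintype V] (hcard : 2 ≤ Fintype.card V) :
    3 * Fintype.card V ≤ T.edgeSet.ncard + (Finset.univ.filter (Ext p)).card + 3 := by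
  obtain ⟨θ, hθ⟩ := exists_theta (p := p) M.inj
  obtain ⟨X, hX⟩ : ∃ X : V → ℝ, X = fun v => (p v).1 + θ * (p v).2 := ⟨_, rfl⟩
  have hXi : ∀ u v, X u = X v → u = v := by rw [hX]; exact hθ
  have hne : (Finset.univ : Finset V).Nonempty := by
    rw [← Finset.card_pos, Finset.card_univ]; omega
  obtain ⟨lo, -, hlo⟩ := Finset.exists_min_image Finset.univ X hne
  obtain ⟨hi, -, hhi⟩ := Finset.exists_max_image Finset.univ X hne
  have hlo' : ∀ v, v ≠ lo → X lo < X v := fun v hv =>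
    lt_of_le_of_ne (hlo v (Finset.mem_univ _)) (fun h => hv (hXi _ _ h).symm)
  have hhi' : ∀ v, v ≠ hi → X v < X hi := fun v hv =>
    lt_of_le_of_ne (hhi v (Finset.mem_univ _)) (fun h => hv (hXi _ _ h))
  have hlohi : lo ≠ hi := by
    rintro rfl
    obtain ⟨a, b, hab⟩ := Fintype.one_lt_card_iff.1 (by omega : 1 < Fintype.card V)
    have : ∀ v, v = lo := by
      intro v
      by_contra h
      have := hlo' v h
      have := hhi' v h
      linarith
    exact hab ((this a).trans (this b).symm)
  haveI : Nonempty V := ⟨lo⟩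
  have Htr : ∀ v, v ≠ hi → ∃ w, T.Adj v w ∧ X v < X w ∧
      ∀ y, T.Adj v y → X v < X y → det2 (p v) (p w) (p y) ≤ 0 := by
    intro v hv
    obtain ⟨w, h1, h2, h3⟩ := M.nb θ hX 1 1 (v := v) (z := hi) (by linarith [hhi' v hv])
    exact ⟨w, h1, by linarith, fun y hy hy' => by linarith [h3 y hy (by linarith)]⟩
  have Hbr : ∀ v, v ≠ hi → ∃ w, T.Adj v w ∧ X v < X w ∧
      ∀ y, T.Adj v y → X v < X y → 0 ≤ det2 (p v) (p w) (p y) := by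
    intro v hv
    obtain ⟨w, h1, h2, h3⟩ := M.nb θ hX 1 (-1) (v := v) (z := hi) (by linarith [hhi' v hv])
    exact ⟨w, h1, by linarith, fun y hy hy' => by linarith [h3 y hy (by linarith)]⟩
  have Htl : ∀ v, v ≠ lo → ∃ w, T.Adj v w ∧ X w < X v ∧
      ∀ y, T.Adj v y → X y < X v → 0 ≤ det2 (p v) (p w) (p y) := by
    intro v hv
    obtain ⟨w, h1, h2, h3⟩ := M.nb θ hX (-1) 1 (v := v) (z := lo) (by linarith [hlo' v hv])
    exact ⟨w, h1, by linarith, fun y hy hy' => by linarith [h3 y hy (by linarith)]⟩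
  have Hbl : ∀ v, v ≠ lo → ∃ w, T.Adj v w ∧ X w < X v ∧
      ∀ y, T.Adj v y → X y < X v → det2 (p v) (p w) (p y) ≤ 0 := by
    intro v hv
    obtain ⟨w, h1, h2, h3⟩ := M.nb θ hX (-1) (-1) (v := v) (z := lo) (by linarith [hlo' v hv])
    exact ⟨w, h1, by linarith, fun y hy hy' => by linarith [h3 y hy (by linarith)]⟩
  choose! tr tr1 tr2 tr3 using Htr
  choose! br br1 br2 br3 using Hbr
  choose! tl tl1 tl2 tl3 using Htl
  choose! bl bl1 bl2 bl3 using Hbl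
  have lr : ∀ v y, T.Adj v y → X v < X y ∨ X y < X v := fun v y h =>
    lt_or_gt_of_ne (fun h' => h.ne (hXi _ _ h'))
  have Ktop : ∀ v, v ≠ lo → v ≠ hi → 0 < det2 (p v) (p (tr v)) (p (tl v)) →
      T.Adj (tr v) (tl v) ∧ Emp p v (tr v) (tl v) := by
    intro v h1 h2 hD
    refine M.triK hD (tr1 v h2) (tl1 v h1) ?_
    rintro y hy ⟨a1, a2⟩
    rcases lr v y hy with h | h
    · linarith [tr3 v h2 y hy h]
    · have := tl3 v h1 y hy h
      rw [dsw2] at this; linarith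
  have Kbot : ∀ v, v ≠ lo → v ≠ hi → 0 < det2 (p v) (p (bl v)) (p (br v)) →
      T.Adj (bl v) (br v) ∧ Emp p v (bl v) (br v) := by
    intro v h1 h2 hD
    refine M.triK hD (bl1 v h1) (br1 v h2) ?_
    rintro y hy ⟨a1, a2⟩
    rcases lr v y hy with h | h
    · have := br3 v h2 y hy h
      rw [dsw2] at this; linarith
    · linarith [bl3 v h1 y hy h]
  have upL : ∀ v, v ≠ lo → v ≠ hi → ¬ 0 < det2 (p v) (p (tr v)) (p (tl v)) →
      ∀ y, T.Adj v y → det2 (p v) (p (tr v)) (p y) ≤ 0 := by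
    intro v h1 h2 hD y hy
    rcases lr v y hy with h | h
    · exact tr3 v h2 y hy h
    · have e := pluck (p v) (p (tr v)) (p (tl v)) (p y) θ
      have a1 := tr2 v h2
      have a2 := tl2 v h1
      have a3 := tl3 v h1 y hy h
      rw [hX] at a1 a2 h
      simp only at a1 a2 h
      by_contra hc
      have b1 := mul_nonneg (sub_nonneg.2 a1.le) a3
      have b2 := mul_pos (sub_pos.2 a2) (not_le.1 hc)
      have b3 := mul_nonneg (sub_nonneg.2 h.le) (by linarith : 0 ≤ - det2 (p v) (p (tr v)) (p (tl v)))
      linarith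
  have loL : ∀ v, v ≠ lo → v ≠ hi → ¬ 0 < det2 (p v) (p (bl v)) (p (br v)) →
      ∀ y, T.Adj v y → det2 (p v) (p (bl v)) (p y) ≤ 0 := by
    intro v h1 h2 hD y hy
    rcases lr v y hy with h | h
    · have e := pluck (p v) (p (bl v)) (p (br v)) (p y) θ
      have a1 := bl2 v h1
      have a2 := br2 v h2
      have a3 := br3 v h2 y hy h
      rw [hX] at a1 a2 h
      simp only at a1 a2 h
      by_contra hc
      have b1 := mul_nonneg (sub_nonneg.2 a1.le) a3
      have b2 := mul_pos (sub_pos.2 a2) (not_le.1 hc)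
      have b3 := mul_nonneg (sub_nonneg.2 h.le) (by linarith : 0 ≤ - det2 (p v) (p (bl v)) (p (br v)))
      linarith
    · exact bl3 v h1 y hy h
  have dis : ∀ v, v ≠ lo → v ≠ hi → ¬ 0 < det2 (p v) (p (tr v)) (p (tl v)) →
      ¬ 0 < det2 (p v) (p (bl v)) (p (br v)) → False := by
    intro v h1 h2 hu hl
    have c1 := upL v h1 h2 hu (bl v) (bl1 v h1)
    have c2 := tr3 v h2 (br v) (br1 v h2) (br2 v h2)
    have e := pluck (p v) (p (tr v)) (p (bl v)) (p (br v)) θ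
    have a1 := tr2 v h2
    have a2 := bl2 v h1
    have a3 := br2 v h2
    have hne : det2 (p v) (p (bl v)) (p (br v)) ≠ 0 := by
      apply M.gp _ _ _ (bl1 v h1).ne (br1 v h2).ne
      intro h; rw [h] at a2; linarith
    have hlt : det2 (p v) (p (bl v)) (p (br v)) < 0 := lt_of_le_of_ne (not_lt.1 hl) hne
    rw [hX] at a1 a2 a3
    simp only at a1 a2 a3
    have b1 := mul_pos (sub_pos.2 a1) (neg_pos.2 hlt)
    have b2 := mul_nonneg (sub_nonneg.2 a2.le) (neg_nonneg.2 c2)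
    have b3 := mul_nonneg (sub_nonneg.2 a3.le) (neg_nonneg.2 c1)
    linarith
  -- finsets
  set Vm : Finset V := (Finset.univ.erase lo).erase hi with hVm
  have memVm : ∀ v, v ∈ Vm ↔ v ≠ hi ∧ v ≠ lo := by intro v; simp [hVm]
  have cVm : Vm.card + 2 = Fintype.card V := by
    rw [hVm, Finset.card_erase_of_mem (by simp [hlohi.symm]), Finset.card_erase_of_mem (by simp),
      Finset.card_univ]
    omega
  set U := Vm.filter (fun v => 0 < det2 (p v) (p (tr v)) (p (tl v))) with hU
  set U' := Vm.filter (fun v => ¬ 0 < det2 (p v) (p (tr v)) (p (tl v))) with hU'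
  set L := Vm.filter (fun v => 0 < det2 (p v) (p (bl v)) (p (br v))) with hL
  set L' := Vm.filter (fun v => ¬ 0 < det2 (p v) (p (bl v)) (p (br v))) with hL'
  have cU : U.card + U'.card = Vm.card := Finset.card_filter_add_card_filter_not _
  have cL : L.card + L'.card = Vm.card := Finset.card_filter_add_card_filter_not _
  have cExt : U'.card + L'.card + 2 ≤ (Finset.univ.filter (Ext p)).card := by
    have h1 : ((U' ∪ L') ∪ {lo, hi}).card = U'.card + L'.card + 2 := by
      rw [Finset.card_union_of_disjoint, Finset.card_union_of_disjoint, Finset.card_pair hlohi]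
      · rw [Finset.disjoint_left]
        intro v hv hv'
        simp only [hU', hL', Finset.mem_filter, memVm] at hv hv'
        exact dis v hv.1.2 hv.1.1 hv.2 hv'.2
      · rw [Finset.disjoint_left]
        intro v hv hv'
        simp only [hU', hL', Finset.mem_union, Finset.mem_filter, memVm] at hv
        simp only [Finset.mem_insert, Finset.mem_singleton] at hv'
        tauto
    rw [← h1]
    apply Finset.card_le_card
    intro v hv
    simp only [hU', hL', Finset.mem_union, Finset.mem_filter, memVm, Finset.mem_insert,
      Finset.mem_singleton] at hv
    simp only [Finset.mem_filter, Finset.mem_univ, true_and]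
    rcases hv with (hv | hv) | rfl | rfl
    · exact ext_of M (tr1 v hv.1.1).ne (upL v hv.1.2 hv.1.1 hv.2)
    · exact ext_of M (bl1 v hv.1.2).ne (loL v hv.1.2 hv.1.1 hv.2)
    · refine ⟨-1, -θ, Or.inl (by norm_num), fun w => ?_⟩
      have := hlo w (Finset.mem_univ _)
      rw [hX] at this
      simp only at this
      linarith
    · refine ⟨1, θ, Or.inl (by norm_num), fun w => ?_⟩
      have := hhi w (Finset.mem_univ _)
      rw [hX] at this
      simp only at this
      linarith
  set F1 := (Finset.univ.erase hi).image (fun v => (v, tr v)) with hF1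
  set F2 := U.image (fun v => (tl v, v)) with hF2
  set F3 := L.image (fun v => (bl v, br v)) with hF3
  have c1 : F1.card + 1 = Fintype.card V := by
    rw [hF1, Finset.card_image_of_injective _ (fun a b h => (Prod.ext_iff.1 h).1),
      Finset.card_erase_of_mem (by simp), Finset.card_univ]
    omega
  have c2 : F2.card = U.card := by
    rw [hF2, Finset.card_image_of_injective _ (fun a b h => (Prod.ext_iff.1 h).2)]
  have c3 : F3.card = L.card := by
    rw [hF3, Finset.card_image_of_injOn]
    intro v hv v' hv' h
    simp only [hL, Finset.coe_filter, Set.mem_setOf_eq, memVm] at hv hv'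
    simp only [Prod.mk.injEq] at h
    obtain ⟨hb, hr⟩ := h
    obtain ⟨⟨v1, v2⟩, vD⟩ := hv
    obtain ⟨⟨v1', v2'⟩, vD'⟩ := hv'
    obtain ⟨k1, k2⟩ := Kbot v v2 v1 vD
    obtain ⟨k1', k2'⟩ := Kbot v' v2' v1' vD'
    rw [← hb, ← hr] at k2' vD'
    have a1 := bl1 v v2
    have a2 := br1 v v1
    have a1' := bl1 v' v2'
    have a2' := br1 v' v1'
    rw [← hb] at a1'
    rw [← hr] at a2'
    by_contra hne
    have x1 := M.coneEmpty (by rw [← dcyc]; exact vD) a2.symm k2.cyc v' a1'.symm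
    have x2 := M.coneEmpty (by rw [← dcyc]; exact vD') a2'.symm k2'.cyc v a1.symm
    have y1 : ¬ 0 < det2 (p (bl v)) (p v') (p v) := fun hh =>
      x1 ⟨hh, by rw [← dcyc]; exact vD'⟩
    have y2 : ¬ 0 < det2 (p (bl v)) (p v) (p v') := fun hh =>
      x2 ⟨hh, by rw [← dcyc]; exact vD⟩
    rw [dsw2] at y2
    exact M.gp (bl v) v' v a1'.ne.symm a1.ne.symm (Ne.symm hne) (by linarith)
  have d12 : Disjoint F1 F2 := by
    rw [Finset.disjoint_left]
    rintro ⟨a, b⟩ h1 h2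
    simp only [hF1, hF2, hU, Finset.mem_image, Finset.mem_erase, Finset.mem_filter, memVm,
      Prod.mk.injEq, Finset.mem_univ] at h1 h2
    obtain ⟨v, hv, rfl, rfl⟩ := h1
    obtain ⟨w, ⟨⟨w1, w2⟩, wD⟩, e1, e2⟩ := h2
    obtain ⟨k1, -⟩ := Ktop w w2 w1 wD
    have a1 := tl2 w w2
    have a2 := tr2 w w1
    rw [e1] at k1 wD a1
    have := tr3 v hv.1 (tr w) k1.symm (by linarith)
    rw [← e2] at this
    rw [dcyc, dcyc] at wD
    linarith
  have d13 : Disjoint F1 F3 := by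
    rw [Finset.disjoint_left]
    rintro ⟨a, b⟩ h1 h2
    simp only [hF1, hF3, hL, Finset.mem_image, Finset.mem_erase, Finset.mem_filter, memVm,
      Prod.mk.injEq, Finset.mem_univ] at h1 h2
    obtain ⟨v, hv, rfl, rfl⟩ := h1
    obtain ⟨w, ⟨⟨w1, w2⟩, wD⟩, e1, e2⟩ := h2
    have a1 := bl1 w w2
    have a2 := bl2 w w2
    rw [e1] at a1 a2
    have := tr3 v hv.1 w a1.symm a2
    rw [e1, e2, dcyc] at wD
    linarith
  have d23 : Disjoint F2 F3 := by
    rw [Finset.disjoint_left]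
    rintro ⟨a, b⟩ h1 h2
    simp only [hF2, hF3, hU, hL, Finset.mem_image, Finset.mem_filter, memVm,
      Prod.mk.injEq] at h1 h2
    obtain ⟨v, ⟨⟨v1, v2⟩, -⟩, e3, e4⟩ := h1
    obtain ⟨w, ⟨⟨w1, w2⟩, wD⟩, e1, e2⟩ := h2
    have a1 := br1 w w1
    have a2 := br2 w w1
    rw [e2, ← e4] at a1 a2
    have := tl3 v v2 w a1.symm a2
    rw [e1, e2, ← e3, ← e4, dcyc, dcyc, dsw2] at wD
    linarith
  have hsub : ∀ x ∈ F1 ∪ F2 ∪ F3, T.Adj x.1 x.2 ∧ X x.1 < X x.2 := by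
    rintro ⟨a, b⟩ hx
    simp only [hF1, hF2, hF3, hU, hL, Finset.mem_union, Finset.mem_image, Finset.mem_filter,
      memVm, Prod.mk.injEq, Finset.mem_erase, Finset.mem_univ] at hx
    rcases hx with (⟨v, hv, rfl, rfl⟩ | ⟨v, ⟨⟨v1, v2⟩, -⟩, rfl, rfl⟩) |
      ⟨v, ⟨⟨v1, v2⟩, vD⟩, rfl, rfl⟩
    · exact ⟨tr1 v hv.1, tr2 v hv.1⟩
    · exact ⟨(tl1 v v2).symm, tl2 v v2⟩
    · exact ⟨(Kbot v v2 v1 vD).1, (bl2 v v2).trans (br2 v v1)⟩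
  have cF : (F1 ∪ F2 ∪ F3).card = F1.card + F2.card + F3.card := by
    rw [Finset.card_union_of_disjoint (Finset.disjoint_union_left.2 ⟨d13, d23⟩),
      Finset.card_union_of_disjoint d12]
  have cE : (F1 ∪ F2 ∪ F3).card ≤ T.edgeSet.ncard := by
    have h1 : ((F1 ∪ F2 ∪ F3).image (fun x : V × V => s(x.1, x.2))).card =
        (F1 ∪ F2 ∪ F3).card := by
      apply Finset.card_image_of_injOn
      rintro ⟨a, b⟩ hx ⟨c, d⟩ hy h
      have hx' := (hsub _ hx).2
      have hy' := (hsub _ hy).2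
      simp only [Sym2.eq_iff] at h hx' hy'
      rcases h with ⟨rfl, rfl⟩ | ⟨rfl, rfl⟩
      · rfl
      · linarith
    rw [← h1, ← Set.ncard_coe_finset]
    apply Set.ncard_le_ncard _ (Set.toFinite _)
    intro e he
    simp only [Finset.coe_image, Set.mem_image] at he
    obtain ⟨x, hx, rfl⟩ := he
    exact (hsub x hx).1
  omega



lemma MaxPlane.next (M : MaxPlane p T) [Fintype V] (ε : ℝ) {u v z : V}
    (hz : 0 < ε * det2 (p u) (p v) (p z)) :
    ∃ w, T.Adj u w ∧ 0 < ε * det2 (p u) (p v) (p w) ∧ ∀ y, T.Adj u y →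
      ¬ (0 < ε * det2 (p u) (p v) (p y) ∧ 0 < ε * det2 (p u) (p y) (p w)) := by
  obtain ⟨w0, hw0, hw0'⟩ := M.half (-ε * ((p v).2 - (p u).2)) (ε * ((p v).1 - (p u).1))
    (u := u) (z := z) (by simp only [det2] at hz; linarith)
  obtain ⟨w, hw, hmax⟩ := argmax
    (Finset.univ.filter fun w => T.Adj u w ∧ 0 < ε * det2 (p u) (p v) (p w))
    ⟨w0, by
      rw [Finset.mem_filter]
      refine ⟨Finset.mem_univ _, hw0, ?_⟩
      simp only [det2]; linarith⟩
    (fun w => ((p v).1 - (p u).1) * ((p w).1 - (p u).1) + ((p v).2 - (p u).2) * ((p w).2 - (p u).2))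
    (fun w => ε * det2 (p u) (p v) (p w))
    (by intro w hw; simp only [Finset.mem_filter] at hw; exact hw.2.2)
  simp only [Finset.mem_filter, Finset.mem_univ, true_and] at hw hmax
  refine ⟨w, hw.1, hw.2, fun y hy hy' => ?_⟩
  have h1 := hmax y ⟨hy, hy'.1⟩
  have hid : (((p v).1 - (p u).1) * ((p y).1 - (p u).1) +
      ((p v).2 - (p u).2) * ((p y).2 - (p u).2)) * (ε * det2 (p u) (p v) (p w)) -
      (((p v).1 - (p u).1) * ((p w).1 - (p u).1) +
      ((p v).2 - (p u).2) * ((p w).2 - (p u).2)) * (ε * det2 (p u) (p v) (p y)) =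
      (((p v).1 - (p u).1) ^ 2 + ((p v).2 - (p u).2) ^ 2) * (ε * det2 (p u) (p y) (p w)) := by
    simp only [det2]; ring
  have hne : 0 < ((p v).1 - (p u).1) ^ 2 + ((p v).2 - (p u).2) ^ 2 := by
    by_contra hh
    have a1 : (p v).1 - (p u).1 = 0 := by
      nlinarith [sq_nonneg ((p v).1 - (p u).1), sq_nonneg ((p v).2 - (p u).2)]
    have a2 : (p v).2 - (p u).2 = 0 := by
      nlinarith [sq_nonneg ((p v).1 - (p u).1), sq_nonneg ((p v).2 - (p u).2)]
    have : det2 (p u) (p v) (p z) = 0 := by simp only [det2, a1, a2]; ring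
    rw [this] at hz; simp at hz
  have := mul_pos hne hy'.2
  linarith

def Ch (p : V → Pt) (T : SimpleGraph V) (u v : V) : Prop :=
  (Ext p u ∧ ∀ w, w ≠ u → w ≠ v → 0 < det2 (p u) (p v) (p w)) ∧ u ≠ v ∨
  (¬ Ext p u ∧ T.Adj u v ∧ p u ∉ convexHull ℝ (p '' {y | T.Adj u y ∧ y ≠ v}))

lemma MaxPlane.inner (M : MaxPlane p T) {a b w x : V} (hab : T.Adj a b)
    (hP : 0 < det2 (p a) (p b) (p w)) (hQ : 0 < det2 (p a) (p x) (p b))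
    (hR : 0 < det2 (p a) (p w) (p x))
    (c1 : ∀ y, T.Adj a y → ¬ (0 < det2 (p a) (p y) (p w) ∧ 0 < det2 (p a) (p b) (p y)))
    (c2 : ∀ y, T.Adj a y → ¬ (0 < det2 (p a) (p y) (p b) ∧ 0 < det2 (p a) (p x) (p y))) :
    Ch p T a b := by
  refine Or.inr ⟨?_, hab, ?_⟩
  · rintro ⟨A, B, hAB, h⟩
    have hb := h b
    have hw := h w
    have hx := h x
    have id1 : det2 (p a) (p w) (p x) * (A * ((p b).1 - (p a).1) + B * ((p b).2 - (p a).2)) +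
      det2 (p a) (p x) (p b) * (A * ((p w).1 - (p a).1) + B * ((p w).2 - (p a).2)) +
      det2 (p a) (p b) (p w) * (A * ((p x).1 - (p a).1) + B * ((p x).2 - (p a).2)) = 0 := by
      simp only [det2]; ring
    have n1 := mul_nonneg hR.le (by linarith :
      0 ≤ -(A * ((p b).1 - (p a).1) + B * ((p b).2 - (p a).2)))
    have n2 := mul_nonneg hQ.le (by linarith :
      0 ≤ -(A * ((p w).1 - (p a).1) + B * ((p w).2 - (p a).2)))
    have n3 := mul_nonneg hP.le (by linarith :
      0 ≤ -(A * ((p x).1 - (p a).1) + B * ((p x).2 - (p a).2)))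
    have e1 : A * ((p b).1 - (p a).1) + B * ((p b).2 - (p a).2) = 0 := by
      have : det2 (p a) (p w) (p x) *
        (A * ((p b).1 - (p a).1) + B * ((p b).2 - (p a).2)) = 0 := by linarith
      exact (mul_eq_zero.1 this).resolve_left hR.ne'
    have e2 : A * ((p w).1 - (p a).1) + B * ((p w).2 - (p a).2) = 0 := by
      have : det2 (p a) (p x) (p b) *
        (A * ((p w).1 - (p a).1) + B * ((p w).2 - (p a).2)) = 0 := by linarith
      exact (mul_eq_zero.1 this).resolve_left hQ.ne'
    have hA : A * det2 (p a) (p b) (p w) = 0 := by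
      simp only [det2]
      linear_combination ((p w).2 - (p a).2) * e1 - ((p b).2 - (p a).2) * e2
    have hB : B * det2 (p a) (p b) (p w) = 0 := by
      simp only [det2]
      linear_combination ((p b).1 - (p a).1) * e2 - ((p w).1 - (p a).1) * e1
    rcases hAB with h | h
    · exact h ((mul_eq_zero.1 hA).resolve_right hP.ne')
    · exact h ((mul_eq_zero.1 hB).resolve_right hP.ne')
  · intro hmem
    have hsub : convexHull ℝ (p '' {y | T.Adj a y ∧ y ≠ b}) ⊆
        {q : Pt | 0 < det2 (p a) q (p x) + det2 (p a) (p w) q} := by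
      apply convexHull_min
      · rintro _ ⟨y, ⟨hy, hyb⟩, rfl⟩
        simp only [Set.mem_ofPred_eq]
        have h1 := c1 y hy
        have h2 := c2 y hy
        have hg := M.gp a b y hab.ne hy.ne hyb.symm
        have id : det2 (p a) (p b) (p w) * det2 (p a) (p y) (p x) =
          det2 (p a) (p w) (p x) * det2 (p a) (p b) (p y) +
          det2 (p a) (p x) (p b) * det2 (p a) (p w) (p y) := by simp only [det2]; ring
        rw [dsw2 (p a) (p y) (p w)] at h1
        rw [dsw2 (p a) (p y) (p b), dsw2 (p a) (p x) (p y)] at h2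
        rcases lt_or_gt_of_ne hg with h | h
        · have k : 0 ≤ det2 (p a) (p y) (p x) := by
            by_contra hh; exact h2 ⟨by linarith, by linarith⟩
          have : 0 < det2 (p a) (p w) (p y) := by
            have k1 := mul_nonneg hP.le k
            have k2 := mul_pos hR (neg_pos.2 h)
            have : 0 < det2 (p a) (p x) (p b) * det2 (p a) (p w) (p y) := by linarith
            exact (pos_iff_pos_of_mul_pos this).1 hQ
          linarith
        · have k : 0 ≤ det2 (p a) (p w) (p y) := by
            by_contra hh; exact h1 ⟨by linarith, h⟩
          have : 0 < det2 (p a) (p y) (p x) := by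
            have k1 := mul_nonneg hQ.le k
            have k2 := mul_pos hR h
            have : 0 < det2 (p a) (p b) (p w) * det2 (p a) (p y) (p x) := by linarith
            exact (pos_iff_pos_of_mul_pos this).1 hP
          linarith
      · intro q hq r hr s t hs ht hst
        simp only [Set.mem_ofPred_eq] at hq hr ⊢
        have hs' : s = 1 - t := by linarith
        have e : s • q + t • r = lp t q r := by
          subst hs'; ext <;> simp [lp]
        rw [e, d2, d3]
        rcases eq_or_lt_of_le ht with h | h
        · rw [← h]; linarith
        · have := mul_nonneg hs hq.le
          have := mul_pos h hr
          subst hs'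
          linarith
    have := hsub hmem
    simp at this

lemma ext_left {u v : V} (hne : p u ≠ p v) (h : ∀ w, w ≠ u → w ≠ v → 0 < det2 (p u) (p v) (p w)) :
    Ext p u := by
  refine ⟨(p v).2 - (p u).2, -((p v).1 - (p u).1), ?_, fun w => ?_⟩
  · by_contra hh
    push Not at hh
    apply hne
    ext
    · linarith [hh.2]
    · linarith [hh.1]
  · have : 0 ≤ det2 (p u) (p v) (p w) := by
      by_cases h1 : w = u
      · subst h1; simp
      by_cases h2 : w = v
      · subst h2; simp
      exact (h w h1 h2).le
    simp only [det2] at this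
    linarith

lemma MaxPlane.charge (M : MaxPlane p T) [Fintype V] {u v : V} (huv : T.Adj u v)
    (hnf : ∀ w x, w ≠ x → s(w, x) ≠ s(u, v) → SegCross (p u) (p v) (p w) (p x) →
      ∃ g h, T.Adj g h ∧ SegCross (p w) (p x) (p g) (p h) ∧ s(g, h) ≠ s(u, v)) :
    Ch p T u v ∨ Ch p T v u := by
  by_cases hl : ∀ w, w ≠ u → w ≠ v → 0 < det2 (p u) (p v) (p w)
  · exact Or.inl (Or.inl ⟨⟨ext_left (fun h => huv.ne (M.inj h)) hl, hl⟩, huv.ne⟩)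
  by_cases hr : ∀ w, w ≠ u → w ≠ v → det2 (p u) (p v) (p w) < 0
  · have hr' : ∀ w, w ≠ v → w ≠ u → 0 < det2 (p v) (p u) (p w) := by
      intro w h1 h2
      rw [dsw]; linarith [hr w h2 h1]
    exact Or.inr (Or.inl ⟨⟨ext_left (fun h => huv.ne (M.inj h).symm) hr', hr'⟩, huv.ne.symm⟩)
  push Not at hl hr
  obtain ⟨x0, hx1, hx2, hx0⟩ := hl
  obtain ⟨w0, hw1, hw2, hw0⟩ := hr
  have hx0' := lt_of_le_of_ne hx0 (M.gp u v x0 huv.ne hx1.symm hx2.symm)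
  have hw0' := lt_of_le_of_ne hw0 (M.gp u v w0 huv.ne hw1.symm hw2.symm).symm
  obtain ⟨w, huw, hw, cw⟩ := M.next 1 (u := u) (v := v) (z := w0) (by linarith)
  obtain ⟨x, hux, hx, cx⟩ := M.next (-1) (u := u) (v := v) (z := x0) (by linarith)
  simp only [one_mul, neg_mul, Left.neg_pos_iff] at hw hx cw cx
  have hQ : 0 < det2 (p u) (p x) (p v) := by rw [dsw2]; linarith
  have c1 : ∀ y, T.Adj u y → ¬ (0 < det2 (p u) (p y) (p w) ∧ 0 < det2 (p u) (p v) (p y)) :=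
    fun y hy h => cw y hy ⟨h.2, h.1⟩
  have c2 : ∀ y, T.Adj u y → ¬ (0 < det2 (p u) (p y) (p v) ∧ 0 < det2 (p u) (p x) (p y)) := by
    intro y hy h
    refine cx y hy ⟨?_, ?_⟩
    · rw [dsw2]; linarith
    · rw [dsw2]; linarith
  obtain ⟨hvw, E1⟩ := M.triK hw huv huw c1
  obtain ⟨hxv, E2⟩ := M.triK hQ hux huv c2
  have hwx : w ≠ x := by rintro rfl; linarith
  have g1 := M.gp v w x hvw.ne hxv.ne.symm hwx
  have g2 := M.gp u w x huw.ne hux.ne hwx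
  have id : det2 (p v) (p w) (p x) - det2 (p u) (p w) (p x) =
    det2 (p u) (p v) (p w) - det2 (p u) (p v) (p x) := by simp only [det2]; ring
  rcases lt_or_gt_of_ne g2 with k2 | k2
  · rcases lt_or_gt_of_ne g1 with k1 | k1
    · right
      have hQ' : 0 < det2 (p v) (p u) (p x) := by rw [dsw]; linarith
      have hP' : 0 < det2 (p v) (p w) (p u) := by rw [← dcyc]; exact hw
      refine M.inner (a := v) (b := u) (w := x) (x := w) huv.symm hQ' hP'
        (by rw [dsw2]; linarith) ?_ ?_
      · exact fun y hy => M.coneEmpty hQ' hux E2.cyc.cyc y hy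
      · exact fun y hy => M.coneEmpty hP' huw.symm E1.cyc y hy
    · exfalso
      obtain ⟨g, h, hgh, hX, hne⟩ := hnf w x hwx (sne huw.ne.symm hvw.ne.symm) (cross_of_signs hw hx k1 k2)
      exact hne (M.flip hw hx k1 k2 huv huw hvw hux hxv.symm E1 E2.cyc.cyc hgh hX)
  · exact Or.inl (M.inner huv hw hQ k2 c1 c2)

lemma MaxPlane.hull (M : MaxPlane p T) [Fintype V] {u : V} (hu : ¬ Ext p u) :
    p u ∈ convexHull ℝ (p '' {y | T.Adj u y}) := by
  have key : ∀ A B : ℝ, (A ≠ 0 ∨ B ≠ 0) → ∃ w, T.Adj u w ∧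
      A * (p u).1 + B * (p u).2 < A * (p w).1 + B * (p w).2 := by
    intro A B h
    by_contra hh
    apply hu
    refine ⟨A, B, h, fun z => ?_⟩
    by_contra hz
    exact hh (M.half A B (lt_of_not_ge hz))
  by_contra hh
  have hcl : IsClosed (convexHull ℝ (p '' {y | T.Adj u y})) :=
    ((Set.toFinite _).isCompact_convexHull (𝕜 := ℝ)).isClosed
  obtain ⟨f, c, h1, h2⟩ := geometric_hahn_banach_point_closed (convex_convexHull ℝ _) hcl hh
  have hf : ∀ q : Pt, f q = f (1, 0) * q.1 + f (0, 1) * q.2 := by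
    intro q
    have : q = q.1 • ((1, 0) : Pt) + q.2 • ((0, 1) : Pt) := by ext <;> simp
    conv_lhs => rw [this]
    rw [map_add, map_smul, map_smul]
    simp only [smul_eq_mul]
    ring
  have h3 : ∀ w, T.Adj u w → f (p u) < f (p w) := fun w hw =>
    h1.trans (h2 _ (subset_convexHull ℝ _ ⟨w, hw, rfl⟩))
  simp only [hf (p _)] at h3
  have hne : f (1, 0) ≠ 0 ∨ f (0, 1) ≠ 0 := by
    by_contra hz
    push Not at hz
    obtain ⟨w, hw, -⟩ := key 1 0 (by simp)
    have := h3 w hw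
    rw [hz.1, hz.2] at this
    simp at this
  obtain ⟨w, hw, hlt⟩ := key (-f (1, 0)) (-f (0, 1)) (by simpa using hne)
  have := h3 w hw
  linarith

lemma MaxPlane.chCard (M : MaxPlane p T) [Fintype V] (u : V) :
    (Finset.univ.filter (Ch p T u)).card ≤ if Ext p u then 1 else 3 := by
  split_ifs with hu
  · rw [Finset.card_le_one]
    intro a ha b hb
    simp only [Finset.mem_filter, Finset.mem_univ, true_and, Ch, hu, not_true_eq_false,
      false_and, or_false] at ha hb
    by_contra hab
    have h1 := ha.1 b hb.2.symm (Ne.symm hab)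
    have h2 := hb.1 a ha.2.symm hab
    rw [dsw2] at h2
    linarith
  · have hm := M.hull hu
    rw [convexHull_eq_union] at hm
    simp only [Set.mem_iUnion] at hm
    obtain ⟨t, hts, hai, hmem⟩ := hm
    have hc : t.card ≤ 3 := by
      have h := hai.card_le_finrank_succ.trans
        (Nat.succ_le_succ ((Submodule.finrank_le _).trans (show Module.finrank ℝ Pt ≤ 2 by simp)))
      simpa using h
    have hsub : (Finset.univ.filter (Ch p T u)).image p ⊆ t := by
      intro q hq
      simp only [Finset.mem_image, Finset.mem_filter, Finset.mem_univ, true_and] at hq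
      obtain ⟨v, hv, rfl⟩ := hq
      by_contra hvt
      simp only [Ch, hu, false_and, false_or, not_false_eq_true, true_and] at hv
      apply hv.2
      refine convexHull_mono ?_ hmem
      intro q hq
      obtain ⟨y, hy, rfl⟩ := hts hq
      refine ⟨y, ⟨hy, ?_⟩, rfl⟩
      rintro rfl
      exact hvt hq
    have := Finset.card_le_card hsub
    rw [Finset.card_image_of_injective _ M.inj] at this
    omega

lemma MaxPlane.countB (M : MaxPlane p T) [Fintype V] (S : Set (Sym2 V))
    (hS : ∀ u v, s(u, v) ∈ S → T.Adj u v ∧ ∀ w x, w ≠ x → s(w, x) ≠ s(u, v) →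
      SegCross (p u) (p v) (p w) (p x) →
      ∃ g h, T.Adj g h ∧ SegCross (p w) (p x) (p g) (p h) ∧ s(g, h) ≠ s(u, v)) :
    S.ncard + 2 * (Finset.univ.filter (Ext p)).card ≤ 3 * Fintype.card V := by
  have h1 : S ⊆ (((Finset.univ.sigma fun u => Finset.univ.filter (Ch p T u)).image
      fun x : (_ : V) × V => s(x.1, x.2) : Finset (Sym2 V)) : Set (Sym2 V)) := by
    intro e he
    induction e using Sym2.ind with
    | _ u v =>
      obtain ⟨a, b⟩ := hS u v he
      simp only [Finset.coe_image, Set.mem_image, Finset.mem_coe, Finset.mem_sigma,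
        Finset.mem_univ, Finset.mem_filter, true_and]
      rcases M.charge a b with h | h
      · exact ⟨⟨u, v⟩, h, rfl⟩
      · exact ⟨⟨v, u⟩, h, Sym2.eq_swap⟩
  have h2 := Set.ncard_le_ncard h1 (Set.toFinite _)
  rw [Set.ncard_coe_finset] at h2
  have h3 := h2.trans Finset.card_image_le
  rw [Finset.card_sigma] at h3
  have h4 := h3.trans (Finset.sum_le_sum fun u _ => M.chCard u)
  rw [Finset.sum_ite] at h4
  simp only [Finset.sum_const, smul_eq_mul, mul_one] at h4
  have h4' : S.ncard ≤ (Finset.univ.filter (Ext p)).card +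
    (Finset.univ.filter (fun x => ¬ Ext p x)).card * 3 := by convert h4
  have h5 := Finset.card_filter_add_card_filter_not (s := (Finset.univ : Finset V)) (Ext p)
  rw [Finset.card_univ] at h5
  omega


lemma ec_iff (a b c d : V) : EdgeCross p s(a, b) s(c, d) ↔ SegCross (p a) (p b) (p c) (p d) := by
  constructor
  · rintro ⟨u, v, x, y, h1, h2, h⟩
    rw [Sym2.eq_iff] at h1 h2
    rcases h1 with ⟨rfl, rfl⟩ | ⟨rfl, rfl⟩ <;> rcases h2 with ⟨rfl, rfl⟩ | ⟨rfl, rfl⟩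
    · exact h
    · exact segCross_comm (segCross_swap1 (segCross_comm h))
    · exact segCross_swap1 h
    · exact segCross_swap1 (segCross_comm (segCross_swap1 (segCross_comm h)))
  · intro h
    exact ⟨a, b, c, d, rfl, rfl, h⟩

lemma ec_comm {e f : Sym2 V} (h : EdgeCross p e f) : EdgeCross p f e := by
  obtain ⟨u, v, x, y, h1, h2, h⟩ := h
  exact ⟨x, y, u, v, h2, h1, segCross_comm h⟩

lemma cf_of {H : SimpleGraph V} (A : Set (Sym2 V))
    (h1 : ∀ e ∈ H.edgeSet, ∀ f ∈ H.edgeSet, e ∈ A → f ∈ A → e ≠ f → ¬ EdgeCross p e f)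
    (h2 : ∀ e ∈ H.edgeSet, ∀ f ∈ H.edgeSet, e ∉ A → f ∉ A → e ≠ f → ¬ EdgeCross p e f) :
    ∃ ψ : Sym2 V → Fin 2, CrossingFree H p ψ := by
  refine ⟨fun e => if e ∈ A then 0 else 1, ?_⟩
  intro e he f hf hne hc
  by_cases a : e ∈ A <;> by_cases b : f ∈ A <;> simp only [a, b, if_true, if_false] at hc
  · exact h1 e he f hf a b hne
  · simp at hc
  · simp at hc
  · exact h2 e he f hf a b hne

def Rg (G : SimpleGraph V) (p : V → Pt) (A : Set (Sym2 V)) : SimpleGraph V where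
  Adj a b := G.Adj a b ∧ (s(a, b) ∈ A ∨ ∀ f ∈ G.edgeSet, f ∈ A → f ≠ s(a, b) →
    ¬ EdgeCross p s(a, b) f)
  symm := ⟨fun a b h => by rw [Sym2.eq_swap]; exact ⟨h.1.symm, h.2⟩⟩
  loopless := ⟨fun a h => h.1.ne rfl⟩

lemma mem_Rg (G : SimpleGraph V) (A : Set (Sym2 V)) (e : Sym2 V) :
    e ∈ (Rg G p A).edgeSet ↔ e ∈ G.edgeSet ∧ (e ∈ A ∨ ∀ f ∈ G.edgeSet, f ∈ A → f ≠ e →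
    ¬ EdgeCross p e f) := by
  induction e using Sym2.ind with
  | _ u v => rfl

lemma rg_plane {G : SimpleGraph V} {A : Set (Sym2 V)}
    (h1 : ∀ e ∈ G.edgeSet, ∀ f ∈ G.edgeSet, e ∈ A → f ∈ A → e ≠ f → ¬ EdgeCross p e f)
    (h2 : ∀ e ∈ G.edgeSet, ∀ f ∈ G.edgeSet, e ∉ A → f ∉ A → e ≠ f → ¬ EdgeCross p e f)
    (e : Sym2 V) (he : e ∈ (Rg G p A).edgeSet) (f : Sym2 V) (hf : f ∈ (Rg G p A).edgeSet)
    (hne : e ≠ f) : ¬ EdgeCross p e f := by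
  rw [mem_Rg] at he hf
  intro hX
  by_cases a : e ∈ A <;> by_cases b : f ∈ A
  · exact h1 e he.1 f hf.1 a b hne hX
  · exact hf.2.resolve_left b e he.1 a hne (ec_comm hX)
  · exact he.2.resolve_left a f hf.1 b hne.symm hX
  · exact h2 e he.1 f hf.1 a b hne hX

lemma mem_add {G : SimpleGraph V} {a b : V} {e : Sym2 V}
    (he : e ∈ (G ⊔ SimpleGraph.fromEdgeSet {s(a, b)}).edgeSet) : e = s(a, b) ∨ e ∈ G.edgeSet := by
  rw [SimpleGraph.edgeSet_sup, SimpleGraph.edgeSet_fromEdgeSet] at he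
  rcases he with h | h
  · exact Or.inr h
  · exact Or.inl h.1

lemma rg_max {G : SimpleGraph V} (hgen : GenPos p) (hsat : Saturated 2 G p) {A : Set (Sym2 V)}
    (h1 : ∀ e ∈ G.edgeSet, ∀ f ∈ G.edgeSet, e ∈ A → f ∈ A → e ≠ f → ¬ EdgeCross p e f)
    (h2 : ∀ e ∈ G.edgeSet, ∀ f ∈ G.edgeSet, e ∉ A → f ∉ A → e ≠ f → ¬ EdgeCross p e f) :
    MaxPlane p (Rg G p A) := by
  refine ⟨hgen.1, gp_of hgen, ?_, ?_⟩
  · intro a b c d hab hcd hX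
    by_contra hne
    exact rg_plane h1 h2 s(a, b) hab s(c, d) hcd hne ((ec_iff a b c d).2 hX)
  · intro a b hab hn
    by_contra hh
    have hno : ∀ f ∈ (Rg G p A).edgeSet, ¬ EdgeCross p s(a, b) f := by
      intro f hf hX
      induction f using Sym2.ind with
      | _ c d => exact hh ⟨c, d, hf, (ec_iff a b c d).1 hX⟩
    by_cases hG : G.Adj a b
    · apply hn
      refine ⟨hG, Or.inr fun f hf hfA hne hX => ?_⟩
      exact hno f ((mem_Rg G A f).2 ⟨hf, Or.inl hfA⟩) hX
    · obtain ⟨ψ, hψ⟩ := cf_of (p := p) (H := G ⊔ SimpleGraph.fromEdgeSet {s(a, b)})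
        (insert s(a, b) (Rg G p A).edgeSet)
        (by
          intro e _ f _ he hf hne hX
          rcases he with rfl | he <;> rcases hf with rfl | hf
          · exact hne rfl
          · exact hno f hf hX
          · exact hno e he (ec_comm hX)
          · exact rg_plane h1 h2 e he f hf hne hX)
        (by
          intro e he f hf he' hf' hne
          rw [Set.mem_insert_iff, not_or] at he' hf'
          have ge := (mem_add he).resolve_left he'.1
          have gf := (mem_add hf).resolve_left hf'.1
          exact h2 e ge f gf (fun h => he'.2 ((mem_Rg G A e).2 ⟨ge, Or.inl h⟩))
            (fun h => hf'.2 ((mem_Rg G A f).2 ⟨gf, Or.inl h⟩)) hne)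
      exact hsat a b hab hG ψ hψ

lemma main [Fintype V] {G : SimpleGraph V} (hc : 3 ≤ Fintype.card V) (hgen : GenPos p)
    (hθ : ∃ φ : Sym2 V → Fin 2, CrossingFree G p φ) (hsat : Saturated 2 G p) :
    3 * Fintype.card V ≤ G.edgeSet.ncard + 6 := by
  obtain ⟨φ, hφ⟩ := hθ
  have a1 : ∀ e ∈ G.edgeSet, ∀ f ∈ G.edgeSet, e ∈ {e | φ e = 0} → f ∈ {e | φ e = 0} → e ≠ f →
      ¬ EdgeCross p e f := fun e he f hf h h' hne =>
    hφ e he f hf hne ((show φ e = 0 from h).trans (show φ f = 0 from h').symm)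
  have a2 : ∀ e ∈ G.edgeSet, ∀ f ∈ G.edgeSet, e ∉ {e | φ e = 0} → f ∉ {e | φ e = 0} → e ≠ f →
      ¬ EdgeCross p e f := fun e he f hf h h' hne => by
    have k1 : φ e ≠ 0 := h
    have k2 : φ f ≠ 0 := h'
    exact hφ e he f hf hne (by omega)
  have MR := rg_max hgen hsat a1 a2
  have pR := rg_plane a1 a2
  have hRA : ∀ e ∈ G.edgeSet, e ∈ {e | φ e = 0} → e ∈ (Rg G p {e | φ e = 0}).edgeSet :=
    fun e he h => (mem_Rg _ _ e).2 ⟨he, Or.inl h⟩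
  have hRG : ∀ e ∈ (Rg G p {e | φ e = 0}).edgeSet, e ∈ G.edgeSet :=
    fun e he => ((mem_Rg _ _ e).1 he).1
  generalize Rg G p {e | φ e = 0} = R at MR pR hRA hRG
  have b1 : ∀ e ∈ G.edgeSet, ∀ f ∈ G.edgeSet, e ∈ R.edgeSetᶜ → f ∈ R.edgeSetᶜ → e ≠ f →
      ¬ EdgeCross p e f := fun e he f hf h h' hne =>
    a2 e he f hf (fun k => h (hRA e he k)) (fun k => h' (hRA f hf k)) hne
  have b2 : ∀ e ∈ G.edgeSet, ∀ f ∈ G.edgeSet, e ∉ R.edgeSetᶜ → f ∉ R.edgeSetᶜ → e ≠ f →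
      ¬ EdgeCross p e f := fun e he f hf h h' hne =>
    pR e (not_not.1 h) f (not_not.1 h') hne
  have MB := rg_max hgen hsat b1 b2
  have hBG : ∀ e ∈ (Rg G p R.edgeSetᶜ).edgeSet, e ∈ G.edgeSet :=
    fun e he => ((mem_Rg _ _ e).1 he).1
  have hSB : ∀ e ∈ R.edgeSet, e ∈ (Rg G p R.edgeSetᶜ).edgeSet →
      ∀ f ∈ G.edgeSet, f ∉ R.edgeSet → f ≠ e → ¬ EdgeCross p e f := by
    intro e he h
    exact ((mem_Rg _ _ e).1 h).2.resolve_left (fun k => k he)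
  generalize Rg G p R.edgeSetᶜ = B at MB hBG hSB
  have cR := MR.countA (by omega)
  have cB := MB.countA (by omega)
  have cS := MR.countB (R.edgeSet ∩ B.edgeSet) (by
    intro u v huv
    refine ⟨huv.1, fun w x hwx hne hX => ?_⟩
    by_contra hh
    have hno : ∀ f ∈ R.edgeSet, f ≠ s(u, v) → ¬ EdgeCross p s(w, x) f := by
      intro f hf hf' hX
      induction f using Sym2.ind with
      | _ c d => exact hh ⟨c, d, hf, (ec_iff w x c d).1 hX, hf'⟩
    have hunc := hSB s(u, v) huv.1 huv.2
    have hX' := (ec_iff u v w x).2 hX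
    by_cases hG : G.Adj w x
    · by_cases hR : s(w, x) ∈ R.edgeSet
      · exact pR _ huv.1 _ hR hne.symm hX'
      · exact hunc _ hG hR hne hX'
    · obtain ⟨ψ, hψ⟩ := cf_of (p := p) (H := G ⊔ SimpleGraph.fromEdgeSet {s(w, x)})
        (insert s(w, x) (R.edgeSet \ {s(u, v)}))
        (by
          intro e _ f _ he hf hne hX
          rcases he with rfl | he <;> rcases hf with rfl | hf
          · exact hne rfl
          · exact hno f hf.1 hf.2 hX
          · exact hno e he.1 he.2 (ec_comm hX)
          · exact pR e he.1 f hf.1 hne hX)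
        (by
          intro e he f hf he' hf' hne
          rw [Set.mem_insert_iff, not_or] at he' hf'
          have ge := (mem_add he).resolve_left he'.1
          have gf := (mem_add hf).resolve_left hf'.1
          by_cases k1 : e = s(u, v)
          · subst k1
            exact hunc f gf (fun h => hf'.2 ⟨h, hne.symm⟩) hne.symm
          · have r1 : e ∉ R.edgeSet := fun h => he'.2 ⟨h, k1⟩
            by_cases k2 : f = s(u, v)
            · subst k2
              exact fun hX => hunc e ge r1 hne (ec_comm hX)
            · exact b1 e ge f gf r1 (fun h => hf'.2 ⟨h, k2⟩) hne)
      exact hsat w x hwx hG ψ hψ)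
  have hU : (R.edgeSet ∪ B.edgeSet).ncard ≤ G.edgeSet.ncard :=
    Set.ncard_le_ncard (Set.union_subset hRG hBG) (Set.toFinite _)
  have hI := Set.ncard_union_add_ncard_inter R.edgeSet B.edgeSet (Set.toFinite _) (Set.toFinite _)
  omega

end TH

/-- Every saturated Θ^2-drawing (vertices in general position,
not necessarily convex) of a graph on `n ≥ 3` vertices has at least `3n - 6`
edges. -/
theorem stmt11 (n : ℕ) (hn : 3 ≤ n)
    (G : SimpleGraph (Fin n)) (p : Fin n → Pt)
    (hgen : GenPos p)
    (hθ : ∃ φ : Sym2 (Fin n) → Fin 2, CrossingFree G p φ)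
    (hsat : Saturated 2 G p) :
    (G.edgeSet.ncard : ℤ) ≥ 3 * (n : ℤ) - 6 := by
  have h := TH.main (by simpa using hn) hgen hθ hsat
  rw [Fintype.card_fin] at h
  omega
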